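/- Fix an integer d ≥ 2 and an index n ∈ {1,…,2d+2}. Then lim_{Z→∞} of [the limsup, as the coordinates r_i (i ≠ n) tend to infinity, of (the limsup as r_n → ∞ of #{Q ∈ Box(r⃗) : p^d divides 𝔯(Q) for some prime p > Z} / #Box(r⃗))] equals 0. -/

import Mathlib

open Filter MvPolynomial

noncomputable section

/-- The `2d × 2d` Sylvester matrix of the two generic binary forms of degree `d`,
with entries taken from the coordinates of `Q` (the first `d+1` coordinates of `Q`
are the coefficients of `F`, the last `d+1` ones those of `G`). -/
def sylvesterMat (d : ℕ) {R : Type*} [CommRing R] (Q : Fin (2 * d + 2) → R) :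
    Matrix (Fin (2 * d)) (Fin (2 * d)) R :=
  Matrix.of fun i j =>
    if hi : (i : ℕ) < d then
      if h : (i : ℕ) ≤ (j : ℕ) ∧ (j : ℕ) ≤ (i : ℕ) + d then
        Q ⟨(j : ℕ) - (i : ℕ), by omega⟩
      else 0
    else
      if h : (i : ℕ) - d ≤ (j : ℕ) ∧ (j : ℕ) ≤ (i : ℕ) then
        Q ⟨d + 1 + ((j : ℕ) - ((i : ℕ) - d)), by omega⟩
      else 0

/-- The generic resultant polynomial `𝔯 ∈ ℤ[x₀,…,x_d,y₀,…,y_d]`: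
the determinant of the Sylvester matrix of the generic binary forms of degree `d`. -/
def resPoly (d : ℕ) : MvPolynomial (Fin (2 * d + 2)) ℤ :=
  Matrix.det (sylvesterMat d fun i => X i)

/-- Evaluation `𝔯(Q)` of the generic resultant at a tuple `Q` with entries in a
commutative ring (i.e. evaluation of the image of `𝔯` under the coefficient map `ℤ → R`). -/
def resEval (d : ℕ) {R : Type*} [CommRing R] (Q : Fin (2 * d + 2) → R) : R :=
  aeval Q (resPoly d)

/-- The set `𝒫 ⊆ ℤ^{2d+2}` identified with `ℙ^{2d+1}(ℚ)`: integer tuples with gcd `1`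
whose first nonzero coordinate is positive. -/
def projPts (d : ℕ) : Set (Fin (2 * d + 2) → ℤ) :=
  {C | Finset.univ.gcd C = 1 ∧ ∃ i, 0 < C i ∧ ∀ j, j < i → C j = 0}

/-- The box of integer tuples with `|xᵢ| ≤ rᵢ` for all `i`. -/
def box {m : ℕ} (r : Fin m → ℝ) : Set (Fin m → ℤ) :=
  {x | ∀ i, |(x i : ℝ)| ≤ r i}

/-- The value `ζ(k)` of the Riemann zeta function at an integer `k` (for `k ≥ 2`). -/
def zetaVal (k : ℕ) : ℝ := ∑' n : ℕ+, (1 : ℝ) / ((n : ℕ) : ℝ) ^ k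

/-- The local factor `π_p^{(k)}`. -/
def piLocal (d p k : ℕ) : ℝ :=
  (Nat.card {Q : Fin (2 * d + 2) → ZMod (p ^ k) // resEval d Q ≠ 0} : ℝ) /
    ((p : ℝ) ^ ((2 * d + 2) * k) * (1 - 1 / (p : ℝ) ^ (2 * d + 2)))

/-- The symmetric integer interval `[-r, r]`. -/
def symIcc (r : ℕ) : Finset ℤ := Finset.Icc (-(r : ℤ)) r

lemma card_symIcc (r : ℕ) : (symIcc r).card = 2 * r + 1 := by
  simp only [symIcc, Int.card_Icc]
  omega

lemma mem_symIcc {r : ℕ} {x : ℤ} : x ∈ symIcc r ↔ x.natAbs ≤ r := by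
  simp only [symIcc, Finset.mem_Icc]
  omega

/-- Truncated sum of reciprocals of the prime divisors of `m` exceeding `Z`. -/
def primeRecip (Z : ℕ) (m : ℤ) : ℝ :=
  ∑ p ∈ m.natAbs.primeFactors with Z < p, (1 : ℝ) / p

/-- The weight `min 1 (primeRecip Z m)`, with value `1` at `m = 0`. -/
def primeWeight (Z : ℕ) (m : ℤ) : ℝ :=
  if m = 0 then 1 else min 1 (primeRecip Z m)

lemma primeRecip_nonneg (Z : ℕ) (m : ℤ) : 0 ≤ primeRecip Z m :=
  Finset.sum_nonneg fun _ _ => by positivity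

lemma primeWeight_nonneg (Z : ℕ) (m : ℤ) : 0 ≤ primeWeight Z m := by
  unfold primeWeight
  split_ifs
  · exact zero_le_one
  · exact le_min zero_le_one (primeRecip_nonneg Z m)

lemma primeWeight_le_one (Z : ℕ) (m : ℤ) : primeWeight Z m ≤ 1 := by
  unfold primeWeight
  split_ifs
  · exact le_rfl
  · exact min_le_left _ _

lemma card_filter_modEq_le (r q : ℕ) (hq : 0 < q) (v : ℤ) :
    (({x ∈ symIcc r | x ≡ v [ZMOD q]}.card : ℕ) : ℝ) ≤ (2 * r + 1 : ℝ) / q + 1 := by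
  have h : symIcc r = Finset.Ioc (-(r : ℤ) - 1) r := by
    ext x; simp only [symIcc, Finset.mem_Icc, Finset.mem_Ioc]; omega
  have hq' : (0 : ℤ) < q := by exact_mod_cast hq
  have hc := Int.Ioc_filter_modEq_card (-(r : ℤ) - 1) r hq' v
  rw [← h] at hc
  have hb : (((({x ∈ symIcc r | x ≡ v [ZMOD q]}.card : ℕ) : ℤ) : ℚ)) ≤ (2 * r + 1 : ℚ) / q + 1 := by
    rw [hc]
    push_cast
    apply max_le _ (by positivity)
    have h1 := Int.floor_le (((r : ℚ) - v) / (q : ℚ))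
    have h2 := (Int.lt_floor_add_one ((-(r : ℚ) - 1 - v) / (q : ℚ))).le
    have h3 : (2 * r + 1 : ℚ) / q = ((r : ℚ) - v) / q - (-(r : ℚ) - 1 - v) / q := by ring
    rw [h3]
    linarith
  have : ((((({x ∈ symIcc r | x ≡ v [ZMOD q]}.card : ℕ) : ℤ) : ℚ)) : ℝ) ≤
    (((2 * r + 1 : ℚ) / q + 1 : ℚ) : ℝ) := by exact_mod_cast hb
  push_cast at this
  exact this

/-- A subset of `[-r, r]` whose image under some map has at most `k` elements and whose fibres
consist of integers congruent modulo `q` has at most `k * ((2 * r + 1) / q + 1)` elements. -/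
lemma card_le_of_fibers_modEq {T : Type*} [DecidableEq T] (r q k : ℕ) (hq : 0 < q)
    (A : Finset ℤ) (hA : A ⊆ symIcc r) (c : ℤ → T) (R : Finset T) (hR : R.card ≤ k)
    (hc : ∀ x ∈ A, c x ∈ R)
    (hmod : ∀ x ∈ A, ∀ y ∈ A, c x = c y → x ≡ y [ZMOD q]) :
    (A.card : ℝ) ≤ k * ((2 * r + 1 : ℝ) / q + 1) := by
  have hfib : ∀ b ∈ R, (({a ∈ A | c a = b}.card : ℕ) : ℝ) ≤ (2 * r + 1 : ℝ) / q + 1 := by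
    intro b _
    rcases Finset.eq_empty_or_nonempty {a ∈ A | c a = b} with h | ⟨v, hv⟩
    · rw [h]; simp; positivity
    · rw [Finset.mem_filter] at hv
      refine le_trans ?_ (card_filter_modEq_le r q hq v)
      exact_mod_cast Finset.card_le_card fun x hx => by
        rw [Finset.mem_filter] at hx ⊢
        exact ⟨hA hx.1, hmod x hx.1 v hv.1 (hx.2.trans hv.2.symm)⟩
  calc (A.card : ℝ) = ∑ b ∈ R, (({a ∈ A | c a = b}.card : ℕ) : ℝ) := by
        exact_mod_cast Finset.card_eq_sum_card_fiberwise hc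
    _ ≤ ∑ b ∈ R, ((2 * r + 1 : ℝ) / q + 1) := Finset.sum_le_sum hfib
    _ = R.card * ((2 * r + 1 : ℝ) / q + 1) := by rw [Finset.sum_const, nsmul_eq_mul]
    _ ≤ _ := by gcongr

lemma card_roots_mod_le (P : Polynomial ℤ) (D : ℕ) (hD : P.natDegree ≤ D) (p : ℕ) [Fact p.Prime] :
    (P.map (Int.castRingHom (ZMod p))).roots.toFinset.card ≤ D :=
  (Multiset.toFinset_card_le _).trans <|
    (Polynomial.card_roots' _).trans <| (Polynomial.natDegree_map_le).trans hD

lemma intCast_mem_roots_mod (P : Polynomial ℤ) (p : ℕ) [Fact p.Prime]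
    (hP : P.map (Int.castRingHom (ZMod p)) ≠ 0) (x : ℤ) (hx : (p : ℤ) ∣ P.eval x) :
    (x : ZMod p) ∈ (P.map (Int.castRingHom (ZMod p))).roots.toFinset := by
  rw [Multiset.mem_toFinset, Polynomial.mem_roots hP, Polynomial.IsRoot]
  have := Polynomial.eval_intCast_map (Int.castRingHom (ZMod p)) P x
  rw [this]
  simpa using (ZMod.intCast_zmod_eq_zero_iff_dvd (P.eval x) p).2 hx

lemma card_filter_prime_dvd_eval_le (P : Polynomial ℤ) (D : ℕ) (hD : P.natDegree ≤ D) (p : ℕ)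
    (hp : p.Prime) (hP : P.map (Int.castRingHom (ZMod p)) ≠ 0) (r : ℕ) :
    (({x ∈ symIcc r | (p : ℤ) ∣ P.eval x}.card : ℕ) : ℝ) ≤ D * ((2 * r + 1 : ℝ) / p + 1) := by
  have : Fact p.Prime := ⟨hp⟩
  refine card_le_of_fibers_modEq r p D hp.pos _ (Finset.filter_subset _ _)
    (fun x => (x : ZMod p)) _ (card_roots_mod_le P D hD p) ?_ ?_
  · intro x hx
    exact intCast_mem_roots_mod P p hP x (Finset.mem_filter.1 hx).2
  · intro x _ y _ h
    exact (ZMod.intCast_eq_intCast_iff x y p).1 h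

lemma map_ne_zero_of_not_dvd_coeff (P : Polynomial ℤ) (p k : ℕ) (h : ¬ (p : ℤ) ∣ P.coeff k) :
    P.map (Int.castRingHom (ZMod p)) ≠ 0 := by
  intro h0
  apply h
  have := congrArg (fun Q => Polynomial.coeff Q k) h0
  simpa [Polynomial.coeff_map, ZMod.intCast_zmod_eq_zero_iff_dvd] using this

lemma card_large_primeFactors_le (m r E : ℕ) (hm : m ≠ 0) (h : m ≤ (r + 1) ^ E) (hr : 0 < r) :
    {p ∈ m.primeFactors | r < p}.card ≤ E := by
  have h1 : (r + 1) ^ {p ∈ m.primeFactors | r < p}.card ≤ ∏ p ∈ m.primeFactors with r < p, p :=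
    Finset.pow_card_le_prod _ _ _ fun p hp => (Finset.mem_filter.1 hp).2
  have h2 : (∏ p ∈ m.primeFactors with r < p, p) ≤ m := by
    apply Nat.le_of_dvd (Nat.pos_of_ne_zero hm)
    exact (Finset.prod_dvd_prod_of_subset _ _ _ (Finset.filter_subset _ _)).trans
      (Nat.prod_primeFactors_dvd m)
  exact (Nat.pow_le_pow_iff_right (by omega)).1 (h1.trans (h2.trans h))

lemma sum_filter_inv_sq_le (s : Finset ℕ) (Z : ℕ) :
    ∑ p ∈ s with Z < p, (1 : ℝ) / (p : ℝ) ^ 2 ≤ 2 / (Z + 1) := by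
  refine le_trans ?_ (sum_Ioo_inv_sq_le (α := ℝ) Z (s.sup id + 1))
  simp only [one_div]
  apply Finset.sum_le_sum_of_subset_of_nonneg
  · intro p hp
    rw [Finset.mem_filter] at hp
    rw [Finset.mem_Ioo]
    exact ⟨hp.2, Nat.lt_succ_of_le (Finset.le_sup (f := id) hp.1)⟩
  · intros; positivity

/-- The mean of `primeWeight Z` over the values on `[-r, r]` of a univariate polynomial is
controlled by the weight of its leading coefficient. -/
lemma sum_primeWeight_eval_le (P : Polynomial ℤ) (D E Z r : ℕ) (hD : P.natDegree ≤ D)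
    (hr : 0 < r) (hE : ∀ y ∈ symIcc r, (P.eval y).natAbs ≤ (r + 1) ^ E) :
    ∑ y ∈ symIcc r, primeWeight Z (P.eval y) ≤
      (2 * r + 1 : ℝ) * (primeWeight Z (P.coeff D) + (4 * D + E) * (1 / r + 1 / (Z + 1))) := by
  have hr' : (0 : ℝ) < r := by exact_mod_cast hr
  by_cases hc : P.coeff D = 0
  · calc _ ≤ ∑ y ∈ symIcc r, (1 : ℝ) := Finset.sum_le_sum fun _ _ => primeWeight_le_one _ _
      _ = (2 * r + 1 : ℝ) * 1 := by simp [card_symIcc]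
      _ ≤ _ := by
        gcongr
        rw [hc, primeWeight, if_pos rfl]
        have : (0 : ℝ) ≤ (4 * D + E) * (1 / r + 1 / (Z + 1)) := by positivity
        linarith
  set c := P.coeff D with hcdef
  have hP0 : P ≠ 0 := by rintro rfl; simp at hcdef; exact hc hcdef
  let T : Finset ℕ := {p ∈ Finset.range (r + 1) | p.Prime ∧ ¬ (p : ℤ) ∣ c}
  have key : ∀ y ∈ symIcc r, primeWeight Z (P.eval y) ≤ primeWeight Z c +
      (if P.eval y = 0 then (1 : ℝ) else 0) + (E : ℝ) / r +
      ∑ p ∈ T with Z < p, (if (p : ℤ) ∣ P.eval y then (1 : ℝ) / p else 0) := by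
    intro y hy
    have hT0 : 0 ≤ ∑ p ∈ T with Z < p, (if (p : ℤ) ∣ P.eval y then (1 : ℝ) / p else 0) :=
      Finset.sum_nonneg fun _ _ => by positivity
    by_cases h0 : P.eval y = 0
    · rw [if_pos h0]
      have h1 := primeWeight_le_one Z (P.eval y)
      have h2 := primeWeight_nonneg Z c
      have : (0 : ℝ) ≤ E / r := by positivity
      linarith
    · rw [if_neg h0]
      have hsub : {p ∈ (P.eval y).natAbs.primeFactors | Z < p} ⊆
          ({p ∈ c.natAbs.primeFactors | Z < p} ∪
            {p ∈ (P.eval y).natAbs.primeFactors | r < p}) ∪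
            {p ∈ T | Z < p ∧ (p : ℤ) ∣ P.eval y} := by
        intro p hp
        rw [Finset.mem_filter, Nat.mem_primeFactors] at hp
        obtain ⟨⟨hpp, hpd, hne⟩, hZ⟩ := hp
        simp only [Finset.mem_union, Finset.mem_filter, Nat.mem_primeFactors, T,
          Finset.mem_range]
        by_cases h1 : (p : ℤ) ∣ c
        · left; left
          exact ⟨⟨hpp, Int.natCast_dvd.1 h1, by simpa using hc⟩, hZ⟩
        · by_cases h2 : r < p
          · left; right; exact ⟨⟨hpp, hpd, hne⟩, h2⟩
          · right
            exact ⟨⟨by omega, hpp, h1⟩, hZ, Int.natCast_dvd.2 hpd⟩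
      have hle : primeRecip Z (P.eval y) ≤ primeRecip Z c + (E : ℝ) / r +
          ∑ p ∈ T with Z < p, (if (p : ℤ) ∣ P.eval y then (1 : ℝ) / p else 0) := by
        have hbig : ∑ p ∈ (P.eval y).natAbs.primeFactors with r < p, (1 : ℝ) / p ≤ E / r := by
          calc _ ≤ ∑ p ∈ (P.eval y).natAbs.primeFactors with r < p, (1 : ℝ) / r := by
                apply Finset.sum_le_sum
                intro p hp
                have : (r : ℝ) ≤ p := by exact_mod_cast (Finset.mem_filter.1 hp).2.le
                gcongr
            _ = ({p ∈ (P.eval y).natAbs.primeFactors | r < p}.card : ℝ) * (1 / r) := by simp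
            _ ≤ E * (1 / r) := by
                gcongr
                exact card_large_primeFactors_le _ r E (by simpa using h0) (hE y hy) hr
            _ = E / r := by ring
        have hu : ∀ A B : Finset ℕ, ∑ p ∈ A ∪ B, (1 : ℝ) / p ≤
            ∑ p ∈ A, (1 : ℝ) / p + ∑ p ∈ B, (1 : ℝ) / p := by
          intro A B
          rw [← Finset.sum_union_inter]
          have : 0 ≤ ∑ p ∈ A ∩ B, (1 : ℝ) / p := Finset.sum_nonneg fun _ _ => by positivity
          linarith
        calc primeRecip Z (P.eval y) ≤ _ :=
              Finset.sum_le_sum_of_subset_of_nonneg hsub fun _ _ _ => by positivity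
          _ ≤ _ := (hu _ _).trans (add_le_add_left (hu _ _) _)
          _ ≤ _ := by
            rw [← Finset.filter_filter, Finset.sum_filter (s := {p ∈ T | Z < p})]
            have : primeRecip Z c = ∑ p ∈ c.natAbs.primeFactors with Z < p, (1 : ℝ) / p := rfl
            linarith
      rw [primeWeight, if_neg h0, primeWeight, if_neg hc]
      have h4 : (0 : ℝ) ≤ E / r := by positivity
      rcases le_total 1 (primeRecip Z c) with h | h
      · rw [min_eq_left h]
        have := min_le_left 1 (primeRecip Z (P.eval y))
        linarith
      · rw [min_eq_right h]
        have := min_le_right 1 (primeRecip Z (P.eval y))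
        linarith
  have hzero : ∑ y ∈ symIcc r, (if P.eval y = 0 then (1 : ℝ) else 0) ≤ D := by
    rw [Finset.sum_boole]
    have : {y ∈ symIcc r | P.eval y = 0} ⊆ P.roots.toFinset := by
      intro y hy
      rw [Multiset.mem_toFinset, Polynomial.mem_roots hP0]
      exact (Finset.mem_filter.1 hy).2
    exact_mod_cast (Finset.card_le_card this).trans <| (Multiset.toFinset_card_le _).trans <|
      (Polynomial.card_roots' _).trans hD
  have hsmall : ∑ y ∈ symIcc r, ∑ p ∈ T with Z < p,
      (if (p : ℤ) ∣ P.eval y then (1 : ℝ) / p else 0) ≤ (2 * r + 1) * (4 * D / (Z + 1)) := by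
    rw [Finset.sum_comm]
    calc _ ≤ ∑ p ∈ T with Z < p, (2 * D * (2 * r + 1)) * ((1 : ℝ) / (p : ℝ) ^ 2) := by
          apply Finset.sum_le_sum
          intro p hp
          simp only [T, Finset.mem_filter, Finset.mem_range] at hp
          obtain ⟨⟨hpr, hpp, hpc⟩, -⟩ := hp
          have hp0 : (0 : ℝ) < p := by exact_mod_cast hpp.pos
          have h1 := card_filter_prime_dvd_eval_le P D hD p hpp
            (map_ne_zero_of_not_dvd_coeff P p D hpc) r
          rw [← Finset.sum_filter, Finset.sum_const, nsmul_eq_mul]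
          have h2 : (1 : ℝ) ≤ (2 * r + 1) / p := by
            rw [le_div_iff₀ hp0]
            have : (p : ℝ) ≤ r := by exact_mod_cast Nat.lt_succ_iff.1 hpr
            linarith
          calc _ ≤ (D * ((2 * r + 1 : ℝ) / p + (2 * r + 1 : ℝ) / p)) * ((1 : ℝ) / p) := by
                gcongr
                exact h1.trans (by gcongr)
            _ = _ := by field_simp; ring
      _ = (2 * D * (2 * r + 1)) * ∑ p ∈ T with Z < p, (1 : ℝ) / (p : ℝ) ^ 2 := by
          rw [Finset.mul_sum]
      _ ≤ (2 * D * (2 * r + 1)) * (2 / (Z + 1)) := by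
          gcongr
          exact sum_filter_inv_sq_le T Z
      _ = _ := by ring
  refine (Finset.sum_le_sum key).trans ?_
  simp only [Finset.sum_add_distrib, Finset.sum_const, card_symIcc, nsmul_eq_mul]
  push_cast
  have hD1 : (D : ℝ) ≤ (2 * r + 1) * (D / r) := by
    rw [mul_div_assoc', le_div_iff₀ hr']
    have : (0 : ℝ) ≤ D := by positivity
    nlinarith
  have e1 : (2 * r + 1 : ℝ) * (primeWeight Z c + (4 * D + E) * (1 / r + 1 / (Z + 1))) =
      (2 * r + 1) * primeWeight Z c + (2 * r + 1) * (D / r) + (2 * r + 1) * (E / r) +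
      (2 * r + 1) * (4 * D / (Z + 1)) + (2 * r + 1) * (3 * D / r + E / (Z + 1)) := by ring
  have e2 : (0 : ℝ) ≤ (2 * r + 1) * (3 * D / r + E / (Z + 1)) := by positivity
  rw [e1]
  linarith

lemma primeWeight_eq_zero_of_le {Z : ℕ} {m : ℤ} (hm : m ≠ 0) (h : m.natAbs ≤ Z) :
    primeWeight Z m = 0 := by
  rw [primeWeight, if_neg hm, primeRecip, Finset.filter_false_of_mem]
  · simp
  · intro p hp
    have := Nat.le_of_mem_primeFactors hp
    omega

lemma exists_nat_mul_inv_add_inv_le (K : ℝ) (hK : 0 ≤ K) {ε : ℝ} (hε : 0 < ε) :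
    ∃ N : ℕ, 0 < N ∧ ∀ r Z : ℕ, N ≤ r → N ≤ Z → K * (1 / (r : ℝ) + 1 / ((Z : ℝ) + 1)) ≤ ε := by
  obtain ⟨N, hN⟩ := exists_nat_gt (2 * K / ε)
  have hN0 : (0 : ℝ) < N := lt_of_le_of_lt (by positivity) hN
  refine ⟨N, by exact_mod_cast hN0, fun r Z hr hZ => ?_⟩
  have hr' : (N : ℝ) ≤ r := by exact_mod_cast hr
  have hZ' : (N : ℝ) ≤ Z := by exact_mod_cast hZ
  have h1 : 1 / (r : ℝ) ≤ 1 / N := by gcongr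
  have h2 : 1 / ((Z : ℝ) + 1) ≤ 1 / N := by gcongr; linarith
  calc K * (1 / (r : ℝ) + 1 / ((Z : ℝ) + 1)) ≤ K * (1 / N + 1 / N) := by gcongr
    _ = 2 * K / N := by ring
    _ ≤ ε := by
      rw [div_lt_iff₀ hε] at hN
      rw [div_le_iff₀ hN0]
      linarith

section Boxes

variable {σ : Type*}

lemma exists_eval_le_pow (S : Finset σ) {h : MvPolynomial σ ℤ}
    (hh : h ∈ supported ℤ (S : Set σ)) :
    ∃ C E : ℕ, ∀ r : ℕ, ∀ Q : σ → ℤ, (∀ i ∈ S, (Q i).natAbs ≤ r) →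
      (eval Q h).natAbs ≤ C * (r + 1) ^ E := by
  rw [supported] at hh
  induction hh using Algebra.adjoin_induction with
  | mem x hx =>
    obtain ⟨j, hj, rfl⟩ := hx
    refine ⟨1, 1, fun r Q hQ => ?_⟩
    have := hQ j (by simpa using hj)
    simp only [eval_X, pow_one]
    omega
  | algebraMap c =>
    exact ⟨c.natAbs, 0, fun r Q _ => by simp⟩
  | add x y _ _ hx hy =>
    obtain ⟨C₁, E₁, h₁⟩ := hx
    obtain ⟨C₂, E₂, h₂⟩ := hy
    refine ⟨C₁ + C₂, max E₁ E₂, fun r Q hQ => ?_⟩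
    rw [map_add, add_mul]
    refine (Int.natAbs_add_le _ _).trans (add_le_add ((h₁ r Q hQ).trans ?_) ((h₂ r Q hQ).trans ?_))
    · exact Nat.mul_le_mul_left _ (Nat.pow_le_pow_right (by omega) (le_max_left _ _))
    · exact Nat.mul_le_mul_left _ (Nat.pow_le_pow_right (by omega) (le_max_right _ _))
  | mul x y _ _ hx hy =>
    obtain ⟨C₁, E₁, h₁⟩ := hx
    obtain ⟨C₂, E₂, h₂⟩ := hy
    refine ⟨C₁ * C₂, E₁ + E₂, fun r Q hQ => ?_⟩
    rw [map_mul, Int.natAbs_mul, pow_add, mul_mul_mul_comm]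
    exact Nat.mul_le_mul (h₁ r Q hQ) (h₂ r Q hQ)

variable [DecidableEq σ]

/-- Regard a multivariate polynomial as a univariate polynomial in the variable `i`. -/
def toUniv (i : σ) : MvPolynomial σ ℤ →ₐ[ℤ] Polynomial (MvPolynomial σ ℤ) :=
  aeval (Function.update (fun j => Polynomial.C (X j)) i Polynomial.X)

lemma toUniv_ne_zero (i : σ) {h : MvPolynomial σ ℤ} (hh : h ≠ 0) : toUniv i h ≠ 0 := by
  intro h0
  apply hh
  have : ∀ g : MvPolynomial σ ℤ, Polynomial.eval (X i) (toUniv i g) = g := by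
    intro g
    induction g using MvPolynomial.induction_on with
    | C a => simp [toUniv]
    | add p q hp hq => simp [hp, hq]
    | mul_X p j hp =>
      rw [map_mul, Polynomial.eval_mul, hp]
      rcases eq_or_ne j i with rfl | hj
      · simp [toUniv]
      · simp [toUniv, hj]
  rw [← this h, h0, Polynomial.eval_zero]

lemma eval_map_toUniv (i : σ) (h : MvPolynomial σ ℤ) (Q : σ → ℤ) (y : ℤ) :
    ((toUniv i h).map (eval Q)).eval y = eval (Function.update Q i y) h := by
  induction h using MvPolynomial.induction_on with
  | C a => simp [toUniv]
  | add p q hp hq => simp [hp, hq]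
  | mul_X p j hp =>
    rw [map_mul, Polynomial.map_mul, Polynomial.eval_mul, hp]
    rcases eq_or_ne j i with rfl | hj
    · simp [toUniv]
    · simp [toUniv, hj]

lemma coeff_toUniv_mem_supported (i : σ) (S : Finset σ) {h : MvPolynomial σ ℤ}
    (hh : h ∈ supported ℤ (S : Set σ)) (k : ℕ) :
    (toUniv i h).coeff k ∈ supported ℤ ((S.erase i : Finset σ) : Set σ) := by
  rw [supported] at hh
  induction hh using Algebra.adjoin_induction generalizing k with
  | mem x hx =>
    obtain ⟨j, hj, rfl⟩ := hx
    rcases eq_or_ne j i with rfl | hji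
    · simp only [toUniv, aeval_X, Function.update_self, Polynomial.coeff_X]
      split_ifs
      · exact one_mem _
      · exact zero_mem _
    · simp only [toUniv, aeval_X, Function.update_of_ne hji, Polynomial.coeff_C]
      split_ifs
      · exact Algebra.subset_adjoin ⟨j, by simpa [hji] using hj, rfl⟩
      · exact zero_mem _
  | algebraMap r =>
    rw [AlgHom.commutes, Polynomial.algebraMap_apply, Polynomial.coeff_C]
    split_ifs
    · exact Subalgebra.algebraMap_mem _ _
    · exact zero_mem _
  | add x y _ _ hx hy =>
    rw [map_add, Polynomial.coeff_add]
    exact add_mem (hx k) (hy k)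
  | mul x y _ _ hx hy =>
    rw [map_mul, Polynomial.coeff_mul]
    exact sum_mem fun c _ => mul_mem (hx _) (hy _)

variable [Fintype σ]

/-- The integer tuples `Q` with `|Q i| ≤ a i` for all `i`, as a finset. -/
def symBox (a : σ → ℕ) : Finset (σ → ℤ) := Fintype.piFinset fun i => symIcc (a i)

lemma mem_symBox {a : σ → ℕ} {Q : σ → ℤ} : Q ∈ symBox a ↔ ∀ i, (Q i).natAbs ≤ a i := by
  simp [symBox, Fintype.mem_piFinset, mem_symIcc]

lemma update_mem_symBox {a : σ → ℕ} {Q : σ → ℤ} (hQ : Q ∈ symBox a) (i : σ) {y : ℤ}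
    (hy : y ∈ symIcc (a i)) : Function.update Q i y ∈ symBox a := by
  rw [mem_symBox] at hQ ⊢
  intro j
  rcases eq_or_ne j i with rfl | h
  · simpa using mem_symIcc.1 hy
  · simpa [h] using hQ j

lemma sum_symBox_sum_update (a : σ → ℕ) (i : σ) (g : (σ → ℤ) → ℝ) :
    ∑ Q ∈ symBox a, ∑ y ∈ symIcc (a i), g (Function.update Q i y) =
      (2 * a i + 1 : ℝ) * ∑ Q ∈ symBox a, g Q := by
  have h : ∑ Q ∈ symBox a, ∑ y ∈ symIcc (a i), g (Function.update Q i y) =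
      ∑ Q ∈ symBox a, ∑ y ∈ symIcc (a i), g Q := by
    rw [← Finset.sum_product', ← Finset.sum_product']
    have hm : ∀ x ∈ symBox a ×ˢ symIcc (a i),
        ((Function.update x.1 i x.2, x.1 i) : (σ → ℤ) × ℤ) ∈ symBox a ×ˢ symIcc (a i) := by
      intro x hx
      rw [Finset.mem_product] at hx ⊢
      exact ⟨update_mem_symBox hx.1 i hx.2, mem_symIcc.2 (mem_symBox.1 hx.1 i)⟩
    refine Finset.sum_bij' (fun x _ => (Function.update x.1 i x.2, x.1 i))
      (fun x _ => (Function.update x.1 i x.2, x.1 i)) hm hm ?_ ?_ ?_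
    · rintro ⟨Q, y⟩ _; simp
    · rintro ⟨Q, y⟩ _; simp
    · rintro ⟨Q, y⟩ _; rfl
  rw [h]
  simp only [Finset.sum_const, card_symIcc, nsmul_eq_mul, Finset.mul_sum]
  push_cast
  rfl

/-- Bounding a sum over a box by bounding its averages along the lines in direction `i`. -/
lemma sum_symBox_le_of_fiber_le (a : σ → ℕ) (i : σ) (g G : (σ → ℤ) → ℝ)
    (h : ∀ Q ∈ symBox a, ∑ y ∈ symIcc (a i), g (Function.update Q i y) ≤
      (2 * a i + 1 : ℝ) * G Q) :
    ∑ Q ∈ symBox a, g Q ≤ ∑ Q ∈ symBox a, G Q := by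
  have h1 := Finset.sum_le_sum h
  rw [sum_symBox_sum_update, ← Finset.mul_sum] at h1
  exact le_of_mul_le_mul_left h1 (by positivity)

/-- The mean of `primeWeight Z` over the values of a nonzero polynomial on boxes tends to zero,
uniformly in the shape of the boxes. -/
theorem exists_sum_primeWeight_le (S : Finset σ) (h : MvPolynomial σ ℤ)
    (hS : h ∈ supported ℤ (S : Set σ)) (h0 : h ≠ 0) {ε : ℝ} (hε : 0 < ε) :
    ∃ N : ℕ, ∀ Z : ℕ, N ≤ Z → ∀ a : σ → ℕ, (∀ i ∈ S, N ≤ a i) →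
      ∑ Q ∈ symBox a, primeWeight Z (eval Q h) ≤ ε * (symBox a).card := by
  induction hn : S.card generalizing S h ε with
  | zero =>
    rw [Finset.card_eq_zero] at hn
    subst hn
    simp only [Finset.coe_empty, supported_empty, Algebra.mem_bot] at hS
    obtain ⟨c, rfl⟩ := hS
    have hc : c ≠ 0 := by rintro rfl; simp at h0
    refine ⟨c.natAbs, fun Z hZ a _ => ?_⟩
    have : ∀ Q ∈ symBox a, primeWeight Z (eval Q (algebraMap ℤ (MvPolynomial σ ℤ) c)) = 0 := by
      intro Q _
      apply primeWeight_eq_zero_of_le <;> simpa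
    rw [Finset.sum_eq_zero this]
    positivity
  | succ k ih =>
    have step : ∀ i ∈ S, ∃ N : ℕ, ∀ Z : ℕ, N ≤ Z → ∀ a : σ → ℕ, (∀ j ∈ S, N ≤ a j) →
        (∀ j ∈ S, a j ≤ a i) →
        ∑ Q ∈ symBox a, primeWeight Z (eval Q h) ≤ ε * (symBox a).card := by
      intro i hi
      set H := toUniv i h with hH
      obtain ⟨N₁, hN₁⟩ := ih (S.erase i) H.leadingCoeff (coeff_toUniv_mem_supported i S hS _)
        (Polynomial.leadingCoeff_ne_zero.2 (toUniv_ne_zero i h0)) (half_pos hε)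
        (by rw [Finset.card_erase_of_mem hi, hn]; rfl)
      obtain ⟨C, E, hCE⟩ := exists_eval_le_pow S hS
      obtain ⟨N₂, hN₂0, hN₂⟩ := exists_nat_mul_inv_add_inv_le
        (4 * H.natDegree + (E + 1 : ℕ)) (by positivity) (half_pos hε)
      refine ⟨max (max N₁ N₂) C, fun Z hZ a ha hmax => ?_⟩
      have hN₁a : ∀ j ∈ S.erase i, N₁ ≤ a j := fun j hj =>
        ((le_max_left _ _).trans (le_max_left _ _)).trans (ha j (Finset.mem_of_mem_erase hj))
      have hrN : max (max N₁ N₂) C ≤ a i := ha i hi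
      have hr : 0 < a i := by omega
      have hfib := sum_symBox_le_of_fiber_le a i (fun Q => primeWeight Z (eval Q h))
        (fun Q => primeWeight Z (eval Q H.leadingCoeff) + ε / 2) (by
          intro Q hQ
          have hsum := sum_primeWeight_eval_le (H.map (eval Q)) H.natDegree (E + 1) Z (a i)
            Polynomial.natDegree_map_le hr (by
              intro y hy
              rw [eval_map_toUniv]
              refine (hCE (a i) _ fun j hj => ?_).trans ?_
              · exact (mem_symBox.1 (update_mem_symBox hQ i hy) j).trans (hmax j hj)
              · rw [pow_succ']
                exact Nat.mul_le_mul_right _ (by omega))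
          simp only [hH, eval_map_toUniv] at hsum
          refine hsum.trans ?_
          have := hN₂ (a i) Z (by omega) (by omega)
          rw [Polynomial.coeff_map]
          simp only [← hH] at this ⊢
          have e : H.coeff H.natDegree = H.leadingCoeff := rfl
          rw [e]
          gcongr)
      refine hfib.trans ?_
      rw [Finset.sum_add_distrib, Finset.sum_const, nsmul_eq_mul]
      have := hN₁ Z (by omega) a hN₁a
      linarith
    choose! N hN using step
    refine ⟨S.sup N, fun Z hZ a ha => ?_⟩
    obtain ⟨i, hi, hmax⟩ := S.exists_max_image a (Finset.card_pos.1 (by omega))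
    have hle : N i ≤ S.sup N := Finset.le_sup hi
    exact hN i hi Z (hle.trans hZ) a (fun j hj => hle.trans (ha j hj)) hmax

end Boxes

lemma eventually_primeCounting_le_mul {ε : ℝ} (hε : 0 < ε) :
    ∀ᶠ n : ℕ in atTop, (Nat.primeCounting n : ℝ) ≤ ε * n := by
  have h1 := tendsto_natCast_atTop_atTop (R := ℝ) |>.eventually
    (Chebyshev.eventually_primeCounting_le one_pos)
  have h2 := (Real.tendsto_log_atTop.comp (tendsto_natCast_atTop_atTop (R := ℝ))).eventually
    (eventually_ge_atTop ((Real.log 4 + 1) / ε))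
  have h3 := (Real.tendsto_log_atTop.comp (tendsto_natCast_atTop_atTop (R := ℝ))).eventually
    (eventually_gt_atTop 0)
  filter_upwards [h1, h2, h3] with n h1 h2 h3
  simp only [Function.comp_apply, Nat.floor_natCast] at h1 h2 h3
  refine h1.trans ?_
  rw [div_le_iff₀ h3]
  rw [div_le_iff₀ hε] at h2
  have : (0 : ℝ) ≤ n := by positivity
  nlinarith

lemma exists_natAbs_eval_le (f : Polynomial ℤ) (d : ℕ) (hd : f.natDegree ≤ d) :
    ∃ C : ℕ, 0 < C ∧ ∀ r : ℕ, ∀ x ∈ symIcc r, (f.eval x).natAbs ≤ C * (r + 1) ^ d := by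
  refine ⟨∑ k ∈ Finset.range (d + 1), (f.coeff k).natAbs + 1, by omega, fun r x hx => ?_⟩
  rw [Polynomial.eval_eq_sum_range' (Nat.lt_succ_of_le hd), add_mul, Finset.sum_mul]
  refine (Int.natAbs_sum_le _ _).trans (le_add_right (Finset.sum_le_sum fun k hk => ?_))
  rw [Int.natAbs_mul, Int.natAbs_pow]
  refine Nat.mul_le_mul_left _ ?_
  calc x.natAbs ^ k ≤ (r + 1) ^ k := Nat.pow_le_pow_left ((mem_symIcc.1 hx).trans (by omega)) _
    _ ≤ (r + 1) ^ d := Nat.pow_le_pow_right (by omega) (by rw [Finset.mem_range] at hk; omega)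

/-- Simple roots modulo `p` lift in at most one way to roots modulo `p ^ d`. -/
lemma modEq_pow_of_simple_root (f : Polynomial ℤ) (p d : ℕ) (hp : p.Prime) (x y : ℤ)
    (hxy : x ≡ y [ZMOD p]) (hx : (p : ℤ) ^ d ∣ f.eval x) (hy : (p : ℤ) ^ d ∣ f.eval y)
    (hs : ¬ (p : ℤ) ∣ f.derivative.eval y) : x ≡ y [ZMOD ((p ^ d : ℕ) : ℤ)] := by
  obtain ⟨k, hk⟩ := f.binomExpansion y (x - y)
  have hpp : Prime (p : ℤ) := Nat.prime_iff_prime_int.1 hp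
  rw [add_sub_cancel] at hk
  have hdiv : (p : ℤ) ∣ x - y := hxy.symm.dvd
  have hco : IsCoprime ((p : ℤ) ^ d) (f.derivative.eval y + k * (x - y)) := by
    apply IsCoprime.pow_left
    rw [Prime.coprime_iff_not_dvd hpp]
    intro h
    exact hs ((dvd_add_left (hdiv.mul_left k)).1 h)
  have h1 : (p : ℤ) ^ d ∣ (f.derivative.eval y + k * (x - y)) * (x - y) := by
    have : (f.derivative.eval y + k * (x - y)) * (x - y) = f.eval x - f.eval y := by
      rw [hk]; ring
    rw [this]
    exact dvd_sub hx hy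
  have h2 := hco.dvd_of_dvd_mul_left h1
  rw [Int.modEq_comm, Int.modEq_iff_dvd]
  push_cast
  exact h2

lemma card_filter_simple_root_le (f : Polynomial ℤ) (d : ℕ) (hd : f.natDegree ≤ d) (hd0 : d ≠ 0)
    (p : ℕ) (hp : p.Prime) (hf : f.map (Int.castRingHom (ZMod p)) ≠ 0) (r : ℕ) :
    (({x ∈ symIcc r | (p : ℤ) ^ d ∣ f.eval x ∧ ¬ (p : ℤ) ∣ f.derivative.eval x}.card : ℕ) : ℝ) ≤
      d * ((2 * r + 1 : ℝ) / ((p ^ d : ℕ) : ℝ) + 1) := by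
  have : Fact p.Prime := ⟨hp⟩
  refine card_le_of_fibers_modEq r (p ^ d) d (Nat.pow_pos hp.pos) _ (Finset.filter_subset _ _)
    (fun x => (x : ZMod p)) _ (card_roots_mod_le f d hd p) ?_ ?_
  · intro x hx
    exact intCast_mem_roots_mod f p hf x
      ((dvd_pow_self _ hd0).trans (Finset.mem_filter.1 hx).2.1)
  · intro x hx y hy h
    rw [Finset.mem_filter] at hx hy
    exact modEq_pow_of_simple_root f p d hp x y ((ZMod.intCast_eq_intCast_iff x y p).1 h)
      hx.2.1 hy.2.1 hy.2.2

open scoped Classical in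
/-- Upper density of the integers at which a polynomial of degree at most `d` takes a value
divisible by the `d`-th power of a large prime. -/
theorem eventually_card_pow_dvd_eval_le (f : Polynomial ℤ) (d Z : ℕ) (hd : f.natDegree ≤ d)
    (hd2 : 2 ≤ d) (Δ : ℤ) (hΔ : Δ ≠ 0)
    (hres : ∃ u v : Polynomial ℤ, f * u + f.derivative * v = Polynomial.C Δ)
    (hmod : ∀ p : ℕ, p.Prime → Z < p → f.map (Int.castRingHom (ZMod p)) ≠ 0)
    {ε : ℝ} (hε : 0 < ε) :
    ∀ᶠ r : ℕ in atTop,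
      (({x ∈ symIcc r | ∃ p : ℕ, p.Prime ∧ Z < p ∧ (p : ℤ) ^ d ∣ f.eval x}.card : ℕ) : ℝ) ≤
        (2 * r + 1 : ℝ) * (d * primeRecip Z Δ + 2 * d / (Z + 1) + ε) := by
  obtain ⟨u, v, huv⟩ := hres
  obtain ⟨C, hC0, hC⟩ := exists_natAbs_eval_le f d hd
  have hf0 : f ≠ 0 := by
    rintro rfl
    simp only [zero_mul, Polynomial.derivative_zero, add_zero] at huv
    exact hΔ (by simpa using huv.symm)
  let W : Finset ℕ := {p ∈ Δ.natAbs.primeFactors | Z < p}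
  have hC0' : (0 : ℝ) < C := by exact_mod_cast hC0
  have hd0' : (0 : ℝ) < d := by exact_mod_cast (by omega : 0 < d)
  have hlim : Tendsto (fun r : ℕ => C * (r + 1)) atTop atTop :=
    tendsto_atTop_mono (fun r => by simp only [id]; nlinarith) tendsto_id
  have hev1 := hlim.eventually
    (eventually_primeCounting_le_mul (ε := ε / (2 * d * C)) (by positivity))
  have hev2 := (tendsto_natCast_atTop_atTop (R := ℝ)).eventually
    (eventually_ge_atTop ((d + d * W.card + ε) / ε))
  filter_upwards [hev1, hev2] with r hr1 hr2
  let V : Finset ℕ := {p ∈ Nat.primesLE (C * (r + 1)) | Z < p}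
  have hVp : ∀ p ∈ V, p.Prime ∧ Z < p := fun p hp => by
    rw [Finset.mem_filter] at hp
    exact ⟨(Nat.mem_primesLE.1 hp.1).2, hp.2⟩
  have hsub : {x ∈ symIcc r | ∃ p : ℕ, p.Prime ∧ Z < p ∧ (p : ℤ) ^ d ∣ f.eval x} ⊆
      (f.roots.toFinset ∪ W.biUnion fun p => {x ∈ symIcc r | (p : ℤ) ∣ f.eval x}) ∪
        V.biUnion fun p => {x ∈ symIcc r |
          (p : ℤ) ^ d ∣ f.eval x ∧ ¬ (p : ℤ) ∣ f.derivative.eval x} := by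
    intro x hx
    rw [Finset.mem_filter] at hx
    obtain ⟨hxr, p, hp, hZ, hdvd⟩ := hx
    have hdvd1 : (p : ℤ) ∣ f.eval x := (dvd_pow_self _ (by omega)).trans hdvd
    simp only [Finset.mem_union, Finset.mem_biUnion, Multiset.mem_toFinset, Finset.mem_filter]
    by_cases h0 : f.eval x = 0
    · left; left
      exact (Polynomial.mem_roots hf0).2 h0
    by_cases h1 : (p : ℤ) ∣ f.derivative.eval x
    · left; right
      refine ⟨p, ?_, hxr, hdvd1⟩
      have h2 : (p : ℤ) ∣ Δ := by
        have := congrArg (Polynomial.eval x) huv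
        simp only [Polynomial.eval_add, Polynomial.eval_mul, Polynomial.eval_C] at this
        rw [← this]
        exact dvd_add (hdvd1.mul_right _) (h1.mul_right _)
      simp only [W, Finset.mem_filter, Nat.mem_primeFactors]
      exact ⟨⟨hp, Int.natCast_dvd.1 h2, by simpa using hΔ⟩, hZ⟩
    · right
      refine ⟨p, ?_, hxr, hdvd, h1⟩
      simp only [V, Finset.mem_filter, Nat.mem_primesLE]
      refine ⟨⟨?_, hp⟩, hZ⟩
      have h2 : p ^ d ≤ (C * (r + 1)) ^ d := by
        have h3 : (p ^ d : ℕ) ∣ (f.eval x).natAbs := by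
          rw [← Int.natCast_dvd]; push_cast; exact hdvd
        calc p ^ d ≤ (f.eval x).natAbs := Nat.le_of_dvd (by omega) h3
          _ ≤ C * (r + 1) ^ d := hC r x hxr
          _ ≤ C ^ d * (r + 1) ^ d := Nat.mul_le_mul_right _ (Nat.le_self_pow (by omega) _)
          _ = _ := (mul_pow _ _ _).symm
      exact (Nat.pow_le_pow_iff_left (by omega)).1 h2
  have hcard := (Finset.card_le_card hsub).trans <| (Finset.card_union_le _ _).trans <|
    add_le_add ((Finset.card_union_le _ _).trans
      (add_le_add_right Finset.card_biUnion_le _)) Finset.card_biUnion_le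
  have hcard' := (Nat.cast_le (α := ℝ)).2 hcard
  push_cast at hcard'
  refine hcard'.trans ?_
  have hA : (f.roots.toFinset.card : ℝ) ≤ d := by
    exact_mod_cast (Multiset.toFinset_card_le _).trans ((Polynomial.card_roots' _).trans hd)
  have hB : ∑ p ∈ W, (({x ∈ symIcc r | (p : ℤ) ∣ f.eval x}.card : ℕ) : ℝ) ≤
      (2 * r + 1) * (d * primeRecip Z Δ) + d * W.card := by
    calc _ ≤ ∑ p ∈ W, (d * ((2 * r + 1 : ℝ) / p + 1)) := by
          apply Finset.sum_le_sum
          intro p hp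
          simp only [W, Finset.mem_filter, Nat.mem_primeFactors] at hp
          exact card_filter_prime_dvd_eval_le f d hd p hp.1.1 (hmod p hp.1.1 hp.2) r
      _ = ∑ p ∈ W, ((d * (2 * r + 1 : ℝ)) * (1 / p) + d) := by
          apply Finset.sum_congr rfl; intros; ring
      _ = _ := by
          rw [Finset.sum_add_distrib, ← Finset.mul_sum, Finset.sum_const, nsmul_eq_mul,
            primeRecip]
          ring
  have hV : ∑ p ∈ V, (({x ∈ symIcc r | (p : ℤ) ^ d ∣ f.eval x ∧
      ¬ (p : ℤ) ∣ f.derivative.eval x}.card : ℕ) : ℝ) ≤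
      (2 * r + 1) * (2 * d / (Z + 1)) + d * (ε / (2 * d * C) * (C * (r + 1))) := by
    calc _ ≤ ∑ p ∈ V, ((d * (2 * r + 1 : ℝ)) * (1 / (p : ℝ) ^ 2) + d) := by
          apply Finset.sum_le_sum
          intro p hp
          obtain ⟨hpp, hpZ⟩ := hVp p hp
          refine (card_filter_simple_root_le f d hd (by omega) p hpp (hmod p hpp hpZ) r).trans ?_
          rw [mul_add, mul_one, mul_assoc, mul_one_div]
          have h1 : (1 : ℝ) ≤ p := by exact_mod_cast hpp.one_lt.le
          have h0 : (0 : ℝ) < (p : ℝ) ^ 2 := by positivity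
          push_cast
          gcongr
      _ = (d * (2 * r + 1 : ℝ)) * ∑ p ∈ V, 1 / (p : ℝ) ^ 2 + d * V.card := by
          rw [Finset.sum_add_distrib, ← Finset.mul_sum, Finset.sum_const, nsmul_eq_mul]
          ring
      _ ≤ (d * (2 * r + 1 : ℝ)) * (2 / (Z + 1)) + d * (ε / (2 * d * C) * (C * (r + 1))) := by
          gcongr
          · exact sum_filter_inv_sq_le _ Z
          · have h1 : V.card ≤ Nat.primeCounting (C * (r + 1)) := by
              rw [← Nat.primesLE_card_eq_primeCounting]
              exact Finset.card_le_card (Finset.filter_subset _ _)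
            refine le_trans (by exact_mod_cast h1) (hr1.trans (le_of_eq ?_))
            push_cast
            rfl
      _ = _ := by ring
  have hsimp : d * (ε / (2 * d * C) * (C * (r + 1 : ℝ))) = ε * (r + 1) / 2 := by
    field_simp
  rw [hsimp] at hV
  rw [div_le_iff₀ hε] at hr2
  have hr0 : (0 : ℝ) ≤ r := by positivity
  nlinarith

open scoped Classical in
lemma card_filter_common_prime_le (Z r : ℕ) (hr : 0 < r) (m : ℤ) :
    (({y ∈ symIcc r | ∃ p : ℕ, p.Prime ∧ Z < p ∧ (p : ℤ) ∣ y ∧ (p : ℤ) ∣ m}.card : ℕ) : ℝ) ≤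
      (2 * r + 1 : ℝ) * (2 * primeWeight Z m + 1 / r) := by
  have hr' : (0 : ℝ) < r := by exact_mod_cast hr
  by_cases hbig : m = 0 ∨ 1 ≤ primeRecip Z m
  · have hw : primeWeight Z m = 1 := by
      rcases hbig with h | h
      · rw [primeWeight, if_pos h]
      · rw [primeWeight, min_eq_left h, ite_self]
    have h1 := Finset.card_le_card (Finset.filter_subset
      (fun y : ℤ => ∃ p : ℕ, p.Prime ∧ Z < p ∧ (p : ℤ) ∣ y ∧ (p : ℤ) ∣ m) (symIcc r))
    rw [card_symIcc] at h1
    have h2 := (Nat.cast_le (α := ℝ)).2 h1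
    push_cast at h2
    rw [hw]
    have : (0 : ℝ) < 1 / r := by positivity
    nlinarith
  push Not at hbig
  obtain ⟨hm, hlt⟩ := hbig
  rw [primeWeight, if_neg hm, min_eq_right hlt.le]
  let T : Finset ℕ := {p ∈ m.natAbs.primeFactors | Z < p}
  have hsub : {y ∈ symIcc r | ∃ p : ℕ, p.Prime ∧ Z < p ∧ (p : ℤ) ∣ y ∧ (p : ℤ) ∣ m} ⊆
      {0} ∪ {p ∈ T | p ≤ r}.biUnion fun p => {y ∈ symIcc r | y ≡ 0 [ZMOD p]} := by
    intro y hy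
    rw [Finset.mem_filter] at hy
    obtain ⟨hyr, p, hp, hZ, hy1, hm1⟩ := hy
    simp only [Finset.mem_union, Finset.mem_singleton, Finset.mem_biUnion, Finset.mem_filter, T,
      Nat.mem_primeFactors]
    by_cases hy0 : y = 0
    · exact Or.inl hy0
    · right
      refine ⟨p, ⟨⟨⟨hp, Int.natCast_dvd.1 hm1, by simpa using hm⟩, hZ⟩, ?_⟩, hyr,
        (Int.modEq_zero_iff_dvd).2 hy1⟩
      exact (Nat.le_of_dvd (by omega) (Int.natCast_dvd.1 hy1)).trans (mem_symIcc.1 hyr)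
  have hcard := (Finset.card_le_card hsub).trans <| (Finset.card_union_le _ _).trans <|
    add_le_add_right Finset.card_biUnion_le _
  have hcard' := (Nat.cast_le (α := ℝ)).2 hcard
  push_cast at hcard'
  refine hcard'.trans ?_
  have hB : ∑ p ∈ T with p ≤ r, (({y ∈ symIcc r | y ≡ 0 [ZMOD p]}.card : ℕ) : ℝ) ≤
      (2 * r + 1) * (2 * primeRecip Z m) := by
    calc _ ≤ ∑ p ∈ T with p ≤ r, ((2 * r + 1 : ℝ) * 2) * (1 / p) := by
          apply Finset.sum_le_sum
          intro p hp
          simp only [T, Finset.mem_filter, Nat.mem_primeFactors] at hp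
          have hp0 := hp.1.1.1.pos
          have hp0' : (0 : ℝ) < p := by exact_mod_cast hp0
          refine (card_filter_modEq_le r p hp0 0).trans ?_
          have h2 : (1 : ℝ) ≤ (2 * r + 1) / p := by
            rw [le_div_iff₀ hp0']
            have : (p : ℝ) ≤ r := by exact_mod_cast hp.2
            linarith
          have : ((2 * r + 1 : ℝ) * 2) * (1 / p) = (2 * r + 1) / p + (2 * r + 1) / p := by ring
          linarith
      _ ≤ ∑ p ∈ T, ((2 * r + 1 : ℝ) * 2) * (1 / p) :=
          Finset.sum_le_sum_of_subset_of_nonneg (Finset.filter_subset _ _)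
            fun _ _ _ => by positivity
      _ = _ := by rw [← Finset.mul_sum, primeRecip]; ring
  have h1 : (1 : ℝ) ≤ (2 * r + 1) * (1 / r) := by
    rw [mul_one_div, le_div_iff₀ hr']; linarith
  simp only [Finset.card_singleton, Nat.cast_one]
  linarith

open scoped Classical in
lemma exists_sum_common_prime_le {σ : Type*} [Fintype σ] [DecidableEq σ] {i j : σ}
    (hij : i ≠ j) {ε : ℝ} (hε : 0 < ε) :
    ∃ N : ℕ, ∀ Z : ℕ, N ≤ Z → ∀ a : σ → ℕ, N ≤ a i → N ≤ a j →
      ∑ Q ∈ symBox a, (if ∃ p : ℕ, p.Prime ∧ Z < p ∧ (p : ℤ) ∣ Q i ∧ (p : ℤ) ∣ Q j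
        then (1 : ℝ) else 0) ≤ ε * (symBox a).card := by
  obtain ⟨N₁, hN₁⟩ := exists_sum_primeWeight_le {j} (X j : MvPolynomial σ ℤ)
    (Algebra.subset_adjoin ⟨j, by simp, rfl⟩) (X_ne_zero j) (ε := ε / 4) (by positivity)
  obtain ⟨N₂, hN₂⟩ := exists_nat_gt (2 / ε)
  have hN₂0 : (0 : ℝ) < N₂ := lt_trans (by positivity) hN₂
  have hN₂0' : 0 < N₂ := by exact_mod_cast hN₂0
  refine ⟨max N₁ N₂, fun Z hZ a hai haj => ?_⟩
  have hfib := sum_symBox_le_of_fiber_le a i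
    (fun Q => if ∃ p : ℕ, p.Prime ∧ Z < p ∧ (p : ℤ) ∣ Q i ∧ (p : ℤ) ∣ Q j then (1 : ℝ) else 0)
    (fun Q => 2 * primeWeight Z (Q j) + 1 / (a i : ℝ)) (by
      intro Q _
      simp only [Function.update_self, Function.update_of_ne hij.symm]
      rw [Finset.sum_boole]
      exact card_filter_common_prime_le Z (a i) (by omega) (Q j))
  refine hfib.trans ?_
  rw [Finset.sum_add_distrib, Finset.sum_const, nsmul_eq_mul, ← Finset.mul_sum]
  have h1 := hN₁ Z (by omega) a (by intro k hk; rw [Finset.mem_singleton] at hk; subst hk; omega)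
  simp only [eval_X] at h1
  have h2 : 1 / (a i : ℝ) ≤ ε / 2 := by
    have : (N₂ : ℝ) ≤ a i := by exact_mod_cast (le_max_right _ _).trans hai
    rw [div_lt_iff₀ hε] at hN₂
    rw [div_le_iff₀ (by linarith)]
    nlinarith
  have h3 : (0 : ℝ) ≤ (symBox a).card := by positivity
  nlinarith

section Resultant

variable {R S : Type*} [CommRing R] [CommRing S]

/-- The dehomogenization of the form with coefficients the first `d + 1` entries of `Q`. -/
def loForm (d : ℕ) (Q : Fin (2 * d + 2) → R) : Polynomial R :=
  ∑ k : Fin (d + 1), Polynomial.monomial (k : ℕ) (Q ⟨k, by omega⟩)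

/-- The dehomogenization of the form with coefficients the last `d + 1` entries of `Q`. -/
def hiForm (d : ℕ) (Q : Fin (2 * d + 2) → R) : Polynomial R :=
  ∑ k : Fin (d + 1), Polynomial.monomial (k : ℕ) (Q ⟨d + 1 + k, by omega⟩)

lemma coeff_loForm (d : ℕ) (Q : Fin (2 * d + 2) → R) (k : ℕ) (hk : k ≤ d) :
    (loForm d Q).coeff k = Q ⟨k, by omega⟩ := by
  rw [loForm, Polynomial.finsetSum_coeff, Finset.sum_eq_single ⟨k, by omega⟩]
  · simp
  · intro b _ hb
    rw [Polynomial.coeff_monomial, if_neg]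
    intro h; exact hb (Fin.ext h)
  · simp

lemma coeff_hiForm (d : ℕ) (Q : Fin (2 * d + 2) → R) (k : ℕ) (hk : k ≤ d) :
    (hiForm d Q).coeff k = Q ⟨d + 1 + k, by omega⟩ := by
  rw [hiForm, Polynomial.finsetSum_coeff, Finset.sum_eq_single ⟨k, by omega⟩]
  · simp
  · intro b _ hb
    rw [Polynomial.coeff_monomial, if_neg]
    intro h; exact hb (Fin.ext h)
  · simp

lemma natDegree_loForm_le (d : ℕ) (Q : Fin (2 * d + 2) → R) : (loForm d Q).natDegree ≤ d :=
  Polynomial.natDegree_sum_le_of_forall_le _ _ fun k _ =>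
    (Polynomial.natDegree_monomial_le _).trans (by omega)

lemma natDegree_hiForm_le (d : ℕ) (Q : Fin (2 * d + 2) → R) : (hiForm d Q).natDegree ≤ d :=
  Polynomial.natDegree_sum_le_of_forall_le _ _ fun k _ =>
    (Polynomial.natDegree_monomial_le _).trans (by omega)

lemma sylvesterMat_map (d : ℕ) (φ : R →+* S) (Q : Fin (2 * d + 2) → R) :
    φ.mapMatrix (sylvesterMat d Q) = sylvesterMat d (φ ∘ Q) := by
  ext i j
  simp only [RingHom.mapMatrix_apply, Matrix.map_apply, sylvesterMat, Matrix.of_apply]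
  split_ifs <;> simp

lemma resEval_eq_det (d : ℕ) (Q : Fin (2 * d + 2) → R) :
    resEval d Q = (sylvesterMat d Q).det := by
  have h := RingHom.map_det (aeval Q : MvPolynomial (Fin (2 * d + 2)) ℤ →ₐ[ℤ] R).toRingHom
    (sylvesterMat d fun i => X i)
  rw [sylvesterMat_map] at h
  have e : ((aeval Q : MvPolynomial (Fin (2 * d + 2)) ℤ →ₐ[ℤ] R).toRingHom ∘ fun i => X i) = Q := by
    ext i; simp
  rw [e] at h
  exact h

lemma map_resEval (d : ℕ) (φ : R →+* S) (Q : Fin (2 * d + 2) → R) :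
    φ (resEval d Q) = resEval d (φ ∘ Q) := by
  rw [resEval_eq_det, resEval_eq_det, RingHom.map_det, sylvesterMat_map]

lemma resEval_eq_resultant (d : ℕ) (Q : Fin (2 * d + 2) → R) :
    resEval d Q = Polynomial.resultant (hiForm d Q) (loForm d Q) d d := by
  rw [resEval_eq_det, Polynomial.resultant, ← Matrix.det_transpose,
    ← Matrix.det_reindex_self (finCongr (two_mul d))]
  congr 1
  ext i j
  induction j using Fin.addCases with
  | left j =>
    simp only [Matrix.reindex_apply, Matrix.submatrix_apply, Matrix.transpose_apply, sylvesterMat,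
      Matrix.of_apply, Polynomial.sylvester, Fin.addCases_left]
    simp only [finCongr_symm, finCongr_apply, Fin.val_cast, Fin.val_castAdd, Fin.is_lt, dite_true,
      Set.mem_Icc]
    split_ifs with h
    · rw [coeff_loForm _ _ _ (by omega)]
    · rfl
  | right j =>
    simp only [Matrix.reindex_apply, Matrix.submatrix_apply, Matrix.transpose_apply, sylvesterMat,
      Matrix.of_apply, Polynomial.sylvester, Fin.addCases_right]
    simp only [finCongr_symm, finCongr_apply, Fin.val_cast, Fin.val_natAdd, Set.mem_Icc]
    rw [dif_neg (by omega)]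
    by_cases h : (j : ℕ) ≤ (i : ℕ) ∧ (i : ℕ) ≤ (j : ℕ) + d
    · rw [dif_pos (by omega), if_pos h, coeff_hiForm _ _ _ (by omega)]
      congr 2
      omega
    · rw [dif_neg (by omega), if_neg h]

/-- The resultant as a polynomial in the `n`-th coordinate, the other coordinates being fixed
to the entries of `Q`. -/
def fiberPoly (d : ℕ) (n : Fin (2 * d + 2)) (Q : Fin (2 * d + 2) → R) : Polynomial R :=
  resEval d (Function.update (fun i => Polynomial.C (Q i)) n Polynomial.X)

lemma map_fiberPoly (d : ℕ) (n : Fin (2 * d + 2)) (φ : R →+* S) (Q : Fin (2 * d + 2) → R) :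
    (fiberPoly d n Q).map φ = fiberPoly d n (φ ∘ Q) := by
  rw [fiberPoly, fiberPoly, ← Polynomial.coe_mapRingHom, map_resEval]
  congr 1
  ext1 i
  rcases eq_or_ne i n with rfl | h
  · simp
  · simp [h]

lemma eval_fiberPoly (d : ℕ) (n : Fin (2 * d + 2)) (Q : Fin (2 * d + 2) → R) (c : R) :
    (fiberPoly d n Q).eval c = resEval d (Function.update Q n c) := by
  rw [fiberPoly, ← Polynomial.coe_evalRingHom, map_resEval]
  congr 1
  ext1 i
  rcases eq_or_ne i n with rfl | h
  · simp
  · simp [h]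

lemma fiberPoly_congr (d : ℕ) (n : Fin (2 * d + 2)) {Q Q' : Fin (2 * d + 2) → R}
    (h : ∀ i, i ≠ n → Q i = Q' i) : fiberPoly d n Q = fiberPoly d n Q' := by
  unfold fiberPoly
  congr 1
  ext1 i
  rcases eq_or_ne i n with rfl | hi
  · simp
  · simp [hi, h i hi]

lemma natDegree_fiberPoly_le (d : ℕ) (n : Fin (2 * d + 2)) (Q : Fin (2 * d + 2) → R) :
    (fiberPoly d n Q).natDegree ≤ d := by
  let w : Fin (2 * d) → ℕ := fun i => if ((i : ℕ) < d ↔ (n : ℕ) < d + 1) then 1 else 0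
  have hw : ∑ i, w i = d := by
    rw [← Equiv.sum_comp (finCongr (two_mul d)).symm, Fin.sum_univ_add]
    by_cases hn : (n : ℕ) < d + 1 <;> simp [w, hn]
  rw [fiberPoly, resEval_eq_det, Matrix.det_apply]
  refine Polynomial.natDegree_sum_le_of_forall_le _ _ fun σ _ => ?_
  refine (Polynomial.natDegree_smul_le _ _).trans ?_
  refine (Polynomial.natDegree_prod_le _ _).trans ?_
  refine le_trans (Finset.sum_le_sum fun i _ => ?_) ((Equiv.sum_comp σ w).trans hw).le
  have hupd : ∀ j : Fin (2 * d + 2), (Function.update (fun i => Polynomial.C (Q i)) n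
      Polynomial.X j).natDegree ≤ if j = n then 1 else 0 := by
    intro j
    rcases eq_or_ne j n with rfl | h
    · simpa using Polynomial.natDegree_X_le
    · simp [h]
  have hupd' : ∀ j : Fin (2 * d + 2), ∀ c : ℕ, (j = n → c = 1) →
      (Function.update (fun i => Polynomial.C (Q i)) n Polynomial.X j).natDegree ≤ c := by
    intro j c h
    refine (hupd j).trans ?_
    split_ifs with hj
    · exact (h hj).ge
    · exact Nat.zero_le _
  by_cases hi : (σ i : ℕ) < d
  · simp only [sylvesterMat, Matrix.of_apply, dif_pos hi]
    split_ifs with h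
    · refine hupd' _ _ fun hj => if_pos ?_
      have hj := congrArg Fin.val hj
      simp only at hj
      omega
    · simp
  · simp only [sylvesterMat, Matrix.of_apply, dif_neg hi]
    split_ifs with h
    · refine hupd' _ _ fun hj => if_pos ?_
      have hj := congrArg Fin.val hj
      simp only at hj
      omega
    · simp

/-- The discriminant, up to normalization, of the resultant with respect to the `n`-th
coordinate. -/
def fiberDiscr (d : ℕ) (n : Fin (2 * d + 2)) (Q : Fin (2 * d + 2) → R) : R :=
  Polynomial.resultant (fiberPoly d n Q) (fiberPoly d n Q).derivative d (d - 1)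

lemma map_fiberDiscr (d : ℕ) (n : Fin (2 * d + 2)) (φ : R →+* S) (Q : Fin (2 * d + 2) → R) :
    φ (fiberDiscr d n Q) = fiberDiscr d n (φ ∘ Q) := by
  rw [fiberDiscr, fiberDiscr, ← Polynomial.resultant_map_map, ← Polynomial.derivative_map,
    map_fiberPoly]

lemma exists_fiberDiscr_eq (d : ℕ) (hd : d ≠ 0) (n : Fin (2 * d + 2))
    (Q : Fin (2 * d + 2) → R) :
    ∃ u v, fiberPoly d n Q * u + (fiberPoly d n Q).derivative * v =
      Polynomial.C (fiberDiscr d n Q) := by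
  obtain ⟨u, v, -, -, h⟩ := Polynomial.exists_mul_add_mul_eq_C_resultant (m := d) (n := d - 1)
    (fiberPoly d n Q) (fiberPoly d n Q).derivative (natDegree_fiberPoly_le d n Q)
    ((Polynomial.natDegree_derivative_le _).trans
      (Nat.sub_le_sub_right (natDegree_fiberPoly_le d n Q) 1)) (Or.inl hd)
  exact ⟨u, v, h⟩

/-- The generic discriminant with respect to the `n`-th coordinate, a polynomial in the other
coordinates. -/
def genericFiberDiscr (d : ℕ) (n : Fin (2 * d + 2)) : MvPolynomial (Fin (2 * d + 2)) ℤ :=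
  fiberDiscr d n (Function.update X n 0)

lemma genericFiberDiscr_mem_supported (d : ℕ) (n : Fin (2 * d + 2)) :
    genericFiberDiscr d n ∈ supported ℤ
      ((Finset.univ.erase n : Finset (Fin (2 * d + 2))) : Set (Fin (2 * d + 2))) := by
  let A := supported ℤ
    ((Finset.univ.erase n : Finset (Fin (2 * d + 2))) : Set (Fin (2 * d + 2)))
  have hmem : ∀ i, Function.update (X : _ → MvPolynomial (Fin (2 * d + 2)) ℤ) n 0 i ∈ A := by
    intro i
    rcases eq_or_ne i n with rfl | h
    · simp
    · simp only [h, ne_eq, not_false_eq_true, Function.update_of_ne]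
      exact Algebra.subset_adjoin ⟨i, by simp [h], rfl⟩
  have h := map_fiberDiscr d n A.val.toRingHom fun i => ⟨_, hmem i⟩
  rw [genericFiberDiscr]
  have e : (A.val.toRingHom ∘ fun i => ⟨_, hmem i⟩) = Function.update X n 0 := by
    ext1 i; rfl
  rw [← e, ← h]
  exact Subtype.prop _

lemma eval_genericFiberDiscr (d : ℕ) (n : Fin (2 * d + 2))
    (φ : MvPolynomial (Fin (2 * d + 2)) ℤ →+* R) (Q : Fin (2 * d + 2) → R)
    (hφ : ∀ i, φ (X i) = Q i) : φ (genericFiberDiscr d n) = fiberDiscr d n Q := by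
  rw [genericFiberDiscr, map_fiberDiscr, fiberDiscr, fiberDiscr]
  rw [fiberPoly_congr d n (Q' := Q)]
  intro i hi
  simp [hi, hφ]

end Resultant

lemma Polynomial.exists_resultant_add_monomial_ne_zero {K : Type*} [Field K] [IsAlgClosed K]
    {d k : ℕ} {F G : Polynomial K} (hF : F.natDegree ≤ d) (hG : G.natDegree ≤ d) (hk : k ≤ d)
    (hG0 : G ≠ 0) (h0 : k ≠ 0 → G.coeff 0 = 0 → F.coeff 0 ≠ 0)
    (h1 : k ≠ d → G.coeff d = 0 → F.coeff d ≠ 0) :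
    ∃ c, Polynomial.resultant G (F + Polynomial.monomial k c) d d ≠ 0 := by
  classical
  have : Infinite K := IsAlgClosed.instInfinite
  obtain ⟨c, hc⟩ := Infinite.exists_notMem_finset
    (insert (-F.coeff d) (G.roots.toFinset.image fun x => -(F.eval x) / x ^ k))
  simp only [Finset.mem_insert, Finset.mem_image, Multiset.mem_toFinset, not_or, not_exists,
    not_and] at hc
  obtain ⟨hc1, hc2⟩ := hc
  refine ⟨c, ?_⟩
  have hdeg : (F + Polynomial.monomial k c).natDegree ≤ d :=
    Polynomial.natDegree_add_le_of_degree_le hF ((Polynomial.natDegree_monomial_le _).trans hk)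
  obtain ⟨e, he⟩ := Nat.exists_eq_add_of_le hG
  have key : Polynomial.resultant G (F + Polynomial.monomial k c) (G.natDegree + e) d ≠ 0 := by
    rw [Polynomial.resultant_add_left_deg _ _ _ _ _ le_rfl,
      Polynomial.resultant_eq_prod_eval _ _ _ hdeg (IsAlgClosed.splits G)]
    refine mul_ne_zero (mul_ne_zero (pow_ne_zero _ (by simp)) ?_)
      (mul_ne_zero (pow_ne_zero _ (by simpa using hG0)) ?_)
    · rcases Nat.eq_zero_or_pos e with rfl | hpos
      · simp
      refine pow_ne_zero _ ?_
      rw [Polynomial.coeff_add, Polynomial.coeff_monomial]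
      split_ifs with hkd
      · intro h; exact hc1 (by linear_combination h)
      · simpa using h1 hkd (Polynomial.coeff_eq_zero_of_natDegree_lt (by omega))
    · rw [Ne, Multiset.prod_eq_zero_iff, Multiset.mem_map]
      rintro ⟨x, hx, hx0⟩
      rw [Polynomial.eval_add, Polynomial.eval_monomial] at hx0
      by_cases hxk : x ^ k = 0
      · have hk0 : k ≠ 0 := by
          rintro rfl
          simp at hxk
        obtain rfl := (pow_eq_zero_iff hk0).mp hxk
        refine h0 hk0 ?_ ?_
        · have := Polynomial.isRoot_of_mem_roots hx
          rwa [Polynomial.coeff_zero_eq_eval_zero]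
        · rw [Polynomial.coeff_zero_eq_eval_zero]
          simpa [hxk] using hx0
      · refine hc2 x hx ?_
        rw [div_eq_iff hxk]
        linear_combination -hx0
  rwa [← he] at key

section Resultant

variable {R : Type*} [CommRing R]

lemma loForm_update (d : ℕ) (Q : Fin (2 * d + 2) → R) (n : Fin (2 * d + 2)) (hn : (n : ℕ) ≤ d)
    (c : R) : loForm d (Function.update Q n c) =
      loForm d (Function.update Q n 0) + Polynomial.monomial (n : ℕ) c := by
  ext m
  by_cases hm : m ≤ d
  · rw [Polynomial.coeff_add, coeff_loForm _ _ _ hm, coeff_loForm _ _ _ hm,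
      Polynomial.coeff_monomial]
    rcases eq_or_ne (n : ℕ) m with rfl | h
    · simp
    · have : (⟨m, by omega⟩ : Fin (2 * d + 2)) ≠ n := fun e => h (by rw [← e])
      simp [this, h]
  · rw [Polynomial.coeff_add, Polynomial.coeff_monomial, if_neg (by omega),
      Polynomial.coeff_eq_zero_of_natDegree_lt ((natDegree_loForm_le _ _).trans_lt (by omega)),
      Polynomial.coeff_eq_zero_of_natDegree_lt ((natDegree_loForm_le _ _).trans_lt (by omega)),
      add_zero]

lemma hiForm_update (d : ℕ) (Q : Fin (2 * d + 2) → R) (n : Fin (2 * d + 2)) (k : ℕ)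
    (hn : (n : ℕ) = d + 1 + k) (c : R) : hiForm d (Function.update Q n c) =
      hiForm d (Function.update Q n 0) + Polynomial.monomial k c := by
  ext m
  by_cases hm : m ≤ d
  · rw [Polynomial.coeff_add, coeff_hiForm _ _ _ hm, coeff_hiForm _ _ _ hm,
      Polynomial.coeff_monomial]
    rcases eq_or_ne k m with rfl | h
    · have : (⟨d + 1 + k, by omega⟩ : Fin (2 * d + 2)) = n := Fin.ext hn.symm
      simp [this]
    · have : (⟨d + 1 + m, by omega⟩ : Fin (2 * d + 2)) ≠ n := fun e => h (by
        have := congrArg Fin.val e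
        simp only at this
        omega)
      simp [this, h]
  · rw [Polynomial.coeff_add, Polynomial.coeff_monomial, if_neg (by omega),
      Polynomial.coeff_eq_zero_of_natDegree_lt ((natDegree_hiForm_le _ _).trans_lt (by omega)),
      Polynomial.coeff_eq_zero_of_natDegree_lt ((natDegree_hiForm_le _ _).trans_lt (by omega)),
      add_zero]

lemma hiForm_update_of_le (d : ℕ) (Q : Fin (2 * d + 2) → R) (n : Fin (2 * d + 2))
    (hn : (n : ℕ) ≤ d) (c : R) : hiForm d (Function.update Q n c) = hiForm d Q := by
  unfold hiForm
  refine Finset.sum_congr rfl fun k _ => ?_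
  rw [Function.update_of_ne]
  intro h
  have := congrArg Fin.val h
  simp only at this
  omega

lemma loForm_update_of_lt (d : ℕ) (Q : Fin (2 * d + 2) → R) (n : Fin (2 * d + 2))
    (hn : d < (n : ℕ)) (c : R) : loForm d (Function.update Q n c) = loForm d Q := by
  unfold loForm
  refine Finset.sum_congr rfl fun k _ => ?_
  rw [Function.update_of_ne]
  intro h
  have := congrArg Fin.val h
  simp only at this
  omega

end Resultant

lemma exists_ne_eq_zero_of_fiberPoly_eq_zero {K : Type*} [Field K] [IsAlgClosed K] {d : ℕ}
    (hd : d ≠ 0) (n : Fin (2 * d + 2)) (q : Fin (2 * d + 2) → K) (h : fiberPoly d n q = 0) :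
    ∃ i j, i ≠ j ∧ i ≠ n ∧ j ≠ n ∧ q i = 0 ∧ q j = 0 := by
  have hres : ∀ c, resEval d (Function.update q n c) = 0 := fun c => by
    rw [← eval_fiberPoly, h, Polynomial.eval_zero]
  by_contra! hcon
  have hne : ∀ {a b : ℕ} (ha : a < 2 * d + 2) (hb : b < 2 * d + 2), a ≠ b → a ≠ n → b ≠ n →
      q ⟨a, ha⟩ = 0 → q ⟨b, hb⟩ ≠ 0 := fun ha hb hab han hbn =>
    hcon ⟨_, ha⟩ ⟨_, hb⟩ (fun e => hab (congrArg Fin.val e)) (fun e => han (congrArg Fin.val e))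
      fun e => hbn (congrArg Fin.val e)
  have hupd : ∀ {a : ℕ} (ha : a < 2 * d + 2), a ≠ n →
      Function.update q n 0 ⟨a, ha⟩ = q ⟨a, ha⟩ := fun ha han =>
    Function.update_of_ne (fun e => han (congrArg Fin.val e)) _ _
  rcases le_or_gt (n : ℕ) d with hn | hn
  · obtain ⟨c, hc⟩ := Polynomial.exists_resultant_add_monomial_ne_zero
      (natDegree_loForm_le d (Function.update q n 0)) (natDegree_hiForm_le d q) hn
      (fun h0 => by
        have e0 := coeff_hiForm d q 0 (by omega)
        have e1 := coeff_hiForm d q 1 (by omega)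
        rw [h0, Polynomial.coeff_zero] at e0 e1
        exact hne _ _ (by omega) (by omega) (by omega) e0.symm e1.symm)
      (fun hn0 => by
        rw [coeff_hiForm _ _ _ (by omega), coeff_loForm _ _ _ (by omega), hupd _ (by omega)]
        exact hne _ _ (by omega) (by omega) (by omega))
      (fun hn0 => by
        rw [coeff_hiForm _ _ _ (by omega), coeff_loForm _ _ _ (by omega), hupd _ (by omega)]
        exact hne _ _ (by omega) (by omega) (by omega))
    have := hres c
    rw [resEval_eq_resultant, loForm_update _ _ _ hn, hiForm_update_of_le _ _ _ hn] at this
    exact hc this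
  · obtain ⟨k, hk⟩ := Nat.exists_eq_add_of_lt hn
    replace hk : (n : ℕ) = d + 1 + k := by omega
    have hkd : k ≤ d := by omega
    obtain ⟨c, hc⟩ := Polynomial.exists_resultant_add_monomial_ne_zero
      (natDegree_hiForm_le d (Function.update q n 0)) (natDegree_loForm_le d q) hkd
      (fun h0 => by
        have e0 := coeff_loForm d q 0 (by omega)
        have e1 := coeff_loForm d q 1 (by omega)
        rw [h0, Polynomial.coeff_zero] at e0 e1
        exact hne _ _ (by omega) (by omega) (by omega) e0.symm e1.symm)
      (fun hn0 => by
        rw [coeff_hiForm _ _ _ (by omega), coeff_loForm _ _ _ (by omega), hupd _ (by omega)]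
        exact hne _ _ (by omega) (by omega) (by omega))
      (fun hn0 => by
        rw [coeff_hiForm _ _ _ (by omega), coeff_loForm _ _ _ (by omega), hupd _ (by omega)]
        exact hne _ _ (by omega) (by omega) (by omega))
    have := hres c
    rw [resEval_eq_resultant, hiForm_update _ _ _ _ hk, loForm_update_of_lt _ _ _ hn,
      Polynomial.resultant_comm] at this
    exact hc ((mul_eq_zero.mp this).resolve_left (pow_ne_zero _ (by simp)))

lemma exists_dvd_of_map_fiberPoly_eq_zero {d : ℕ} (hd : d ≠ 0) (n : Fin (2 * d + 2))
    (Q : Fin (2 * d + 2) → ℤ) {p : ℕ} (hp : p.Prime)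
    (h : (fiberPoly d n Q).map (Int.castRingHom (ZMod p)) = 0) :
    ∃ i j, i ≠ j ∧ i ≠ n ∧ j ≠ n ∧ (p : ℤ) ∣ Q i ∧ (p : ℤ) ∣ Q j := by
  have := Fact.mk hp
  have h2 := congrArg (Polynomial.map (algebraMap (ZMod p) (AlgebraicClosure (ZMod p)))) h
  rw [map_fiberPoly, map_fiberPoly, Polynomial.map_zero] at h2
  obtain ⟨i, j, hij, hi, hj, h3, h4⟩ := exists_ne_eq_zero_of_fiberPoly_eq_zero hd n _ h2
  simp only [Function.comp_apply, map_eq_zero, eq_intCast,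
    ZMod.intCast_zmod_eq_zero_iff_dvd] at h3 h4
  exact ⟨i, j, hij, hi, hj, h3, h4⟩

lemma Polynomial.resultant_derivative_ne_zero {K : Type*} [Field K] [CharZero K]
    {f : Polynomial K} (hf : f.Separable) :
    Polynomial.resultant f f.derivative f.natDegree (f.natDegree - 1) ≠ 0 := by
  rw [← Polynomial.natDegree_derivative f]
  exact Polynomial.resultant_ne_zero f _ hf

lemma exists_loForm_eq_hiForm_eq {R : Type*} [CommRing R] (d : ℕ) (F G : Polynomial R)
    (hF : F.natDegree ≤ d) (hG : G.natDegree ≤ d) :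
    ∃ q : Fin (2 * d + 2) → R, loForm d q = F ∧ hiForm d q = G := by
  refine ⟨fun i => if (i : ℕ) ≤ d then F.coeff i else G.coeff (i - (d + 1)), ?_, ?_⟩ <;> ext m <;>
    by_cases hm : m ≤ d
  · rw [coeff_loForm _ _ _ hm, if_pos hm]
  · rw [Polynomial.coeff_eq_zero_of_natDegree_lt ((natDegree_loForm_le _ _).trans_lt (by omega)),
      Polynomial.coeff_eq_zero_of_natDegree_lt (by omega)]
  · rw [coeff_hiForm _ _ _ hm, if_neg (by simp only; omega)]
    congr 1
    simp only
    omega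
  · rw [Polynomial.coeff_eq_zero_of_natDegree_lt ((natDegree_hiForm_le _ _).trans_lt (by omega)),
      Polynomial.coeff_eq_zero_of_natDegree_lt (by omega)]

lemma resultant_derivative_ne_zero_of_eval_eq {d k l : ℕ} (hk : k ≤ d) (hl : l ≤ d)
    (hkl : l + 1 = k ∨ k + 1 = l) {s : ℚ} (hs : s ≠ 0) {f : Polynomial ℚ}
    (hf : ∀ c, f.eval c = s * Polynomial.resultant
      (∏ j ∈ Finset.range d, (Polynomial.X - Polynomial.C ((j : ℚ) + 1)))
      (Polynomial.X ^ l + Polynomial.monomial k c) d d) :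
    Polynomial.resultant f f.derivative d (d - 1) ≠ 0 := by
  have hpos : ∀ j : ℕ, (j : ℚ) + 1 ≠ 0 := fun j => by positivity
  have hG : (∏ j ∈ Finset.range d, (Polynomial.X - Polynomial.C ((j : ℚ) + 1))).natDegree = d := by
    rw [Polynomial.natDegree_finsetProd_X_sub_C_eq_card, Finset.card_range]
  have hu : s * ∏ j ∈ Finset.range d, ((j : ℚ) + 1) ^ k ≠ 0 :=
    mul_ne_zero hs (Finset.prod_ne_zero_iff.mpr fun j _ => pow_ne_zero _ (hpos j))
  have hprod : f = Polynomial.C (s * ∏ j ∈ Finset.range d, ((j : ℚ) + 1) ^ k) *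
      ∏ j ∈ Finset.range d,
        (Polynomial.X - Polynomial.C (-(((j : ℚ) + 1) ^ l / ((j : ℚ) + 1) ^ k))) := by
    refine Polynomial.funext fun c => ?_
    have hdeg : (Polynomial.X ^ l + Polynomial.monomial k c : Polynomial ℚ).natDegree ≤ d :=
      Polynomial.natDegree_add_le_of_degree_le ((Polynomial.natDegree_X_pow_le _).trans hl)
        ((Polynomial.natDegree_monomial_le _).trans hk)
    have h1 := Polynomial.resultant_prod_left (Finset.range d)
      (fun j : ℕ => Polynomial.X - Polynomial.C ((j : ℚ) + 1))
      (Polynomial.X ^ l + Polynomial.monomial k c) d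
      (by simp only [Polynomial.leadingCoeff_X_sub_C]; simp) hdeg
    rw [hG] at h1
    rw [hf, h1, Polynomial.eval_mul, Polynomial.eval_C, Polynomial.eval_prod, mul_assoc,
      ← Finset.prod_mul_distrib]
    congr 1
    refine Finset.prod_congr rfl fun j _ => ?_
    rw [Polynomial.natDegree_X_sub_C, Polynomial.resultant_X_sub_C_left _ _ _ hdeg]
    have := pow_ne_zero k (hpos j)
    simp
    field_simp
    ring
  have hfdeg : f.natDegree = d := by
    rw [hprod, Polynomial.natDegree_C_mul hu, Polynomial.natDegree_finsetProd_X_sub_C_eq_card,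
      Finset.card_range]
  have hsep : f.Separable := by
    rw [hprod]
    refine Polynomial.Separable.unit_mul (Polynomial.isUnit_C.mpr hu.isUnit)
      (Polynomial.separable_prod_X_sub_C_iff'.mpr fun i _ j _ hij => ?_)
    have hi := hpos i
    have hj := hpos j
    rcases hkl with rfl | rfl
    · simp only [pow_succ] at hij
      field_simp at hij
      simpa using hij.symm
    · simp only [pow_succ] at hij
      field_simp at hij
      simpa using hij
  have := Polynomial.resultant_derivative_ne_zero hsep
  rwa [hfdeg] at this

lemma genericFiberDiscr_ne_zero {d : ℕ} (hd : d ≠ 0) (n : Fin (2 * d + 2)) :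
    genericFiberDiscr d n ≠ 0 := by
  suffices h : ∃ q : Fin (2 * d + 2) → ℚ, fiberDiscr d n q ≠ 0 by
    obtain ⟨q, hq⟩ := h
    intro h0
    refine hq ?_
    rw [← eval_genericFiberDiscr d n (eval₂Hom (Int.castRingHom ℚ) q) q (by simp), h0, map_zero]
  set G : Polynomial ℚ := ∏ j ∈ Finset.range d, (Polynomial.X - Polynomial.C ((j : ℚ) + 1)) with hG
  have hGdeg : G.natDegree ≤ d := by
    rw [hG, Polynomial.natDegree_finsetProd_X_sub_C_eq_card, Finset.card_range]
  have hadj : ∀ k ≤ d, ∃ l ≤ d, l + 1 = k ∨ k + 1 = l := by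
    intro k hk
    rcases Nat.eq_zero_or_pos k with rfl | hk0
    · exact ⟨1, by omega, by omega⟩
    · exact ⟨k - 1, by omega, by omega⟩
  rcases le_or_gt (n : ℕ) d with hn | hn
  · obtain ⟨l, hl, hkl⟩ := hadj n hn
    obtain ⟨q, hlo, hhi⟩ := exists_loForm_eq_hiForm_eq d (Polynomial.X ^ l) G
      ((Polynomial.natDegree_X_pow_le _).trans hl) hGdeg
    have hq : Function.update q n 0 = q := by
      have := coeff_loForm d q n hn
      rw [hlo, Polynomial.coeff_X_pow, if_neg (by omega)] at this
      exact Function.update_eq_self_iff.mpr this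
    refine ⟨q, resultant_derivative_ne_zero_of_eval_eq hn hl hkl one_ne_zero fun c => ?_⟩
    rw [eval_fiberPoly, resEval_eq_resultant, loForm_update _ _ _ hn, hiForm_update_of_le _ _ _ hn,
      hq, hlo, hhi, one_mul]
  · obtain ⟨k, hk⟩ := Nat.exists_eq_add_of_lt hn
    replace hk : (n : ℕ) = d + 1 + k := by omega
    have hkd : k ≤ d := by omega
    obtain ⟨l, hl, hkl⟩ := hadj k hkd
    obtain ⟨q, hlo, hhi⟩ := exists_loForm_eq_hiForm_eq d G (Polynomial.X ^ l)
      hGdeg ((Polynomial.natDegree_X_pow_le _).trans hl)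
    have hq : Function.update q n 0 = q := by
      have := coeff_hiForm d q k hkd
      rw [hhi, Polynomial.coeff_X_pow, if_neg (by omega)] at this
      rw [Function.update_eq_self_iff, this]
      congr 1
      exact Fin.ext hk.symm
    refine ⟨q, resultant_derivative_ne_zero_of_eval_eq hkd hl hkl
      (pow_ne_zero (d * d) (neg_ne_zero.mpr one_ne_zero)) fun c => ?_⟩
    rw [eval_fiberPoly, resEval_eq_resultant, hiForm_update _ _ _ _ hk, loForm_update_of_lt _ _ _ hn,
      hq, hlo, hhi, Polynomial.resultant_comm]

lemma primeWeight_of_lt_one {Z : ℕ} {m : ℤ} (h : primeWeight Z m < 1) :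
    m ≠ 0 ∧ primeWeight Z m = primeRecip Z m := by
  rw [primeWeight] at h ⊢
  split_ifs at h ⊢ with hm
  · exact absurd h (lt_irrefl _)
  · refine ⟨hm, min_eq_right ?_⟩
    by_contra! h1
    rw [min_eq_left h1.le] at h
    exact lt_irrefl _ h

/-- Ordered pairs of distinct indices, both different from `n`. -/
def offPairs {σ : Type*} [Fintype σ] [DecidableEq σ] (n : σ) : Finset (σ × σ) :=
  {e | e.1 ≠ e.2 ∧ e.1 ≠ n ∧ e.2 ≠ n}

open scoped Classical in
lemma eventually_card_fiber_le {d : ℕ} (hd : 2 ≤ d) (n : Fin (2 * d + 2)) (Z : ℕ)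
    (Q : Fin (2 * d + 2) → ℤ) {ε : ℝ} (hε : 0 < ε) :
    ∀ᶠ r : ℕ in atTop, ((symIcc r).filter fun x => ∃ p : ℕ, p.Prime ∧ Z < p ∧
        (p : ℤ) ^ d ∣ resEval d (Function.update Q n x)).card ≤
      (2 * r + 1 : ℝ) * (d * primeWeight Z (fiberDiscr d n Q) +
        (∑ e ∈ offPairs n, if ∃ p : ℕ, p.Prime ∧ Z < p ∧ (p : ℤ) ∣ Q e.1 ∧ (p : ℤ) ∣ Q e.2
          then (1 : ℝ) else 0) + 2 * d / (Z + 1) + ε) := by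
  have hw := primeWeight_nonneg Z (fiberDiscr d n Q)
  have hd1 : (1 : ℝ) ≤ d := by exact_mod_cast (by omega : 1 ≤ d)
  have hZ : 0 ≤ 2 * (d : ℝ) / (Z + 1) := by positivity
  have hnn : ∀ e ∈ offPairs n, (0 : ℝ) ≤ if ∃ p : ℕ, p.Prime ∧ Z < p ∧ (p : ℤ) ∣ Q e.1 ∧
      (p : ℤ) ∣ Q e.2 then (1 : ℝ) else 0 := fun e _ => by split_ifs <;> simp
  have hsum := Finset.sum_nonneg hnn
  have htriv : ∀ {B : ℝ}, 1 ≤ B → ∀ᶠ r : ℕ in atTop, ((symIcc r).filter fun x => ∃ p : ℕ,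
      p.Prime ∧ Z < p ∧ (p : ℤ) ^ d ∣ resEval d (Function.update Q n x)).card ≤
        (2 * r + 1 : ℝ) * B := fun hB => .of_forall fun r => by
    have h1 : ((symIcc r).filter fun x => ∃ p : ℕ, p.Prime ∧ Z < p ∧
        (p : ℤ) ^ d ∣ resEval d (Function.update Q n x)).card ≤ 2 * r + 1 :=
      (Finset.card_filter_le _ _).trans (card_symIcc r).le
    have h2 : (((symIcc r).filter fun x => ∃ p : ℕ, p.Prime ∧ Z < p ∧
        (p : ℤ) ^ d ∣ resEval d (Function.update Q n x)).card : ℝ) ≤ 2 * r + 1 := by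
      exact_mod_cast h1
    exact h2.trans (le_mul_of_one_le_right (by positivity) hB)
  by_cases hpair : ∃ e ∈ offPairs n, ∃ p : ℕ, p.Prime ∧ Z < p ∧ (p : ℤ) ∣ Q e.1 ∧ (p : ℤ) ∣ Q e.2
  · obtain ⟨e, he, hp⟩ := hpair
    have h1 := Finset.single_le_sum hnn he
    rw [if_pos hp] at h1
    have : 0 ≤ d * primeWeight Z (fiberDiscr d n Q) := by positivity
    exact htriv (by linarith)
  rcases (primeWeight_le_one Z (fiberDiscr d n Q)).eq_or_lt with h1 | h1
  · rw [h1]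
    exact htriv (by linarith)
  obtain ⟨hΔ, heq⟩ := primeWeight_of_lt_one h1
  have hmod : ∀ p : ℕ, p.Prime → Z < p →
      (fiberPoly d n Q).map (Int.castRingHom (ZMod p)) ≠ 0 := fun p hp hZp h0 => by
    obtain ⟨i, j, hij, hi, hj, h2, h3⟩ :=
      exists_dvd_of_map_fiberPoly_eq_zero (by omega) n Q hp h0
    exact hpair ⟨(i, j), by simp [offPairs, hij, hi, hj], p, hp, hZp, h2, h3⟩
  filter_upwards [eventually_card_pow_dvd_eval_le (fiberPoly d n Q) d Z
    (natDegree_fiberPoly_le d n Q) hd _ hΔ (exists_fiberDiscr_eq d (by omega) n Q) hmod hε]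
    with r hr
  simp only [eval_fiberPoly] at hr
  refine hr.trans ?_
  rw [heq]
  gcongr
  linarith

lemma fiberDiscr_congr {R : Type*} [CommRing R] (d : ℕ) (n : Fin (2 * d + 2))
    {Q Q' : Fin (2 * d + 2) → R} (h : ∀ i, i ≠ n → Q i = Q' i) :
    fiberDiscr d n Q = fiberDiscr d n Q' := by
  rw [fiberDiscr, fiberDiscr, fiberPoly_congr d n h]

open scoped Classical in
lemma eventually_card_symBox_filter_le {d : ℕ} (hd : 2 ≤ d) (n : Fin (2 * d + 2)) (Z : ℕ)
    (a : Fin (2 * d + 2) → ℕ) {ε : ℝ} (hε : 0 < ε) :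
    ∀ᶠ r : ℕ in atTop, (((symBox (Function.update a n r)).filter fun Q => ∃ p : ℕ, p.Prime ∧
        Z < p ∧ (p : ℤ) ^ d ∣ resEval d Q).card : ℝ) ≤
      ∑ Q ∈ symBox (Function.update a n r), (d * primeWeight Z (fiberDiscr d n Q) +
        (∑ e ∈ offPairs n, if ∃ p : ℕ, p.Prime ∧ Z < p ∧ (p : ℤ) ∣ Q e.1 ∧ (p : ℤ) ∣ Q e.2
          then (1 : ℝ) else 0) + 2 * d / (Z + 1) + ε) := by
  have hall := (Filter.eventually_all_finset (symBox (Function.update a n 0))).mpr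
    fun Q _ => eventually_card_fiber_le hd n Z Q hε
  filter_upwards [hall] with r hr
  rw [Finset.card_filter, Nat.cast_sum]
  refine sum_symBox_le_of_fiber_le _ n _ _ fun Q hQ => ?_
  have hQ0 : Function.update Q n 0 ∈ symBox (Function.update a n 0) := by
    rw [mem_symBox] at hQ ⊢
    intro i
    rcases eq_or_ne i n with rfl | h
    · simp
    · simpa [h] using hQ i
  have h1 := hr _ hQ0
  have h2 : fiberDiscr d n (Function.update Q n 0) = fiberDiscr d n Q :=
    fiberDiscr_congr d n fun i hi => Function.update_of_ne hi _ _
  have h3 : (∑ e ∈ offPairs n, if ∃ p : ℕ, p.Prime ∧ Z < p ∧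
        (p : ℤ) ∣ Function.update Q n 0 e.1 ∧ (p : ℤ) ∣ Function.update Q n 0 e.2
          then (1 : ℝ) else 0) = ∑ e ∈ offPairs n, if ∃ p : ℕ, p.Prime ∧ Z < p ∧
        (p : ℤ) ∣ Q e.1 ∧ (p : ℤ) ∣ Q e.2 then (1 : ℝ) else 0 := by
    refine Finset.sum_congr rfl fun e he => ?_
    simp only [offPairs, Finset.mem_filter] at he
    rw [Function.update_of_ne he.2.2.1, Function.update_of_ne he.2.2.2]
  rw [h2, h3] at h1
  simp only [Function.update_idem] at h1
  simp only [Function.update_self]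
  refine le_trans (le_of_eq ?_) h1
  rw [Finset.card_filter, Nat.cast_sum]

open scoped Classical in
lemma exists_eventually_card_le {d : ℕ} (hd : 2 ≤ d) (n : Fin (2 * d + 2)) {ε : ℝ}
    (hε : 0 < ε) :
    ∃ N : ℕ, ∀ Z : ℕ, N ≤ Z → ∀ a : Fin (2 * d + 2) → ℕ, (∀ i, i ≠ n → N ≤ a i) →
      ∀ᶠ r : ℕ in atTop, (((symBox (Function.update a n r)).filter fun Q => ∃ p : ℕ, p.Prime ∧
        Z < p ∧ (p : ℤ) ^ d ∣ resEval d Q).card : ℝ) ≤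
          ε * (symBox (Function.update a n r)).card := by
  have hd0 : (0 : ℝ) < d := by exact_mod_cast (by omega : 0 < d)
  obtain ⟨N₁, hN₁⟩ := exists_sum_primeWeight_le _ (genericFiberDiscr d n)
    (genericFiberDiscr_mem_supported d n) (genericFiberDiscr_ne_zero (by omega) n)
    (ε := ε / (4 * d)) (by positivity)
  have hpairs : ∀ e : Fin (2 * d + 2) × Fin (2 * d + 2), ∃ N : ℕ, e.1 ≠ e.2 → ∀ Z : ℕ, N ≤ Z →
      ∀ a : Fin (2 * d + 2) → ℕ, N ≤ a e.1 → N ≤ a e.2 →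
        ∑ Q ∈ symBox a, (if ∃ p : ℕ, p.Prime ∧ Z < p ∧ (p : ℤ) ∣ Q e.1 ∧ (p : ℤ) ∣ Q e.2
          then (1 : ℝ) else 0) ≤ ε / (4 * ((offPairs n).card + 1)) * (symBox a).card := fun e => by
    by_cases he : e.1 = e.2
    · exact ⟨0, fun h => absurd he h⟩
    · obtain ⟨N, hN⟩ := exists_sum_common_prime_le he
        (ε := ε / (4 * ((offPairs n).card + 1))) (by positivity)
      exact ⟨N, fun _ => hN⟩
  choose M hM using hpairs
  obtain ⟨N₃, hN₃⟩ := exists_nat_gt (8 * d / ε)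
  refine ⟨N₁ + (offPairs n).sup M + N₃, fun Z hZ a ha => ?_⟩
  filter_upwards [eventually_card_symBox_filter_le hd n Z a (ε := ε / 4) (by positivity)]
    with r hr
  refine hr.trans ?_
  have hb : ∀ i, i ≠ n →
      N₁ + (offPairs n).sup M + N₃ ≤ Function.update a n r i := fun i hi => by
    rw [Function.update_of_ne hi]
    exact ha i hi
  generalize Function.update a n r = b at hb ⊢
  have h1 := hN₁ Z (by omega) b fun i hi => by
    have := hb i (by simpa using hi)
    omega
  have h2 : ∑ Q ∈ symBox b, ∑ e ∈ offPairs n, (if ∃ p : ℕ, p.Prime ∧ Z < p ∧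
      (p : ℤ) ∣ Q e.1 ∧ (p : ℤ) ∣ Q e.2 then (1 : ℝ) else 0) ≤ ε / 4 * (symBox b).card := by
    rw [Finset.sum_comm]
    calc _ ≤ ∑ e ∈ offPairs n, ε / (4 * ((offPairs n).card + 1)) * (symBox b).card := by
          refine Finset.sum_le_sum fun e he => ?_
          have hle := Finset.le_sup (f := M) he
          simp only [offPairs, Finset.mem_filter] at he
          have e1 := hb _ he.2.2.1
          have e2 := hb _ he.2.2.2
          simp only [offPairs] at hle e1 e2 hZ
          exact hM e he.2.1 Z (by omega) b (by omega) (by omega)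
      _ = (offPairs n).card / ((offPairs n).card + 1) * (ε / 4 * (symBox b).card) := by
          rw [Finset.sum_const, nsmul_eq_mul]
          field_simp
      _ ≤ 1 * (ε / 4 * (symBox b).card) := by
          gcongr
          rw [div_le_one (by positivity)]
          linarith
      _ = _ := one_mul _
  have h3 : 2 * (d : ℝ) / (Z + 1) ≤ ε / 4 := by
    have hZ' : (N₃ : ℝ) ≤ Z := by exact_mod_cast (by omega : N₃ ≤ Z)
    rw [div_lt_iff₀ hε] at hN₃
    rw [div_le_iff₀ (by positivity)]
    nlinarith
  have hdiscr : ∀ Q : Fin (2 * d + 2) → ℤ, eval Q (genericFiberDiscr d n) = fiberDiscr d n Q :=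
    fun Q => eval_genericFiberDiscr d n (eval Q) Q (by simp)
  simp only [hdiscr] at h1
  simp only [Finset.sum_add_distrib, Finset.sum_const, nsmul_eq_mul, ← Finset.mul_sum]
  have h4 : d * ∑ Q ∈ symBox b, primeWeight Z (fiberDiscr d n Q) ≤ ε / 4 * (symBox b).card := by
    refine (mul_le_mul_of_nonneg_left h1 hd0.le).trans (le_of_eq ?_)
    field_simp
  have h5 : ((symBox b).card : ℝ) * (2 * d / (Z + 1)) ≤ (symBox b).card * (ε / 4) := by gcongr
  linarith

lemma box_subset_symBox {m : ℕ} (s : Fin m → ℝ) : box s ⊆ symBox fun i => ⌊s i⌋₊ := by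
  intro x hx
  rw [Finset.mem_coe, mem_symBox]
  intro i
  refine Nat.le_floor ?_
  rw [Nat.cast_natAbs, Int.cast_abs]
  exact hx i

lemma box_eq_symBox {m : ℕ} {s : Fin m → ℝ} (hs : ∀ i, 0 ≤ s i) :
    box s = symBox fun i => ⌊s i⌋₊ := by
  refine (box_subset_symBox s).antisymm fun x hx i => ?_
  rw [Finset.mem_coe, mem_symBox] at hx
  have := (Nat.le_floor_iff (hs i)).mp (hx i)
  rwa [Nat.cast_natAbs, Int.cast_abs] at this

lemma natCard_inter_box_div_mem_Icc {m : ℕ} (A : Set (Fin m → ℤ)) (s : Fin m → ℝ) :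
    (Nat.card ↥(A ∩ box s) : ℝ) / Nat.card ↥(box s) ∈ Set.Icc 0 1 := by
  refine ⟨by positivity, div_le_one_of_le₀ ?_ (by positivity)⟩
  exact_mod_cast Nat.card_mono ((Finset.finite_toSet _).subset (box_subset_symBox s))
    Set.inter_subset_right

lemma limsup_mem_Icc_of_forall_mem {α : Type*} {l : Filter α} [l.NeBot] {u : α → ℝ} {a b : ℝ}
    (h : ∀ x, u x ∈ Set.Icc a b) : limsup u l ∈ Set.Icc a b :=
  ⟨le_limsup_of_frequently_le (Frequently.of_forall fun x => (h x).1)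
      (isBoundedUnder_of ⟨b, fun x => (h x).2⟩),
    limsup_le_of_le (isBoundedUnder_of ⟨a, fun x => (h x).1⟩).isCoboundedUnder_le
      (.of_forall fun x => (h x).2)⟩

lemma natCard_setOf_inter_box (d : ℕ) {Z : ℝ} (hZ : 0 ≤ Z) {s : Fin (2 * d + 2) → ℝ}
    (hs : ∀ i, 0 ≤ s i) :
    open scoped Classical in
    Nat.card ↥({Q : Fin (2 * d + 2) → ℤ |
      ∃ p : ℕ, p.Prime ∧ Z < (p : ℝ) ∧ (p : ℤ) ^ d ∣ resEval d Q} ∩ box s) =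
      ((symBox fun i => ⌊s i⌋₊).filter fun Q => ∃ p : ℕ, p.Prime ∧ ⌊Z⌋₊ < p ∧
        (p : ℤ) ^ d ∣ resEval d Q).card := by
  rw [box_eq_symBox hs, Nat.card_coe_set_eq, ← Set.ncard_coe_finset, Finset.coe_filter]
  congr 1
  ext Q
  simp only [Nat.floor_lt hZ, Set.mem_inter_iff, Set.mem_ofPred_eq, Finset.mem_coe]
  exact and_comm

/-- tuples in a box whose resultant value is divisible by `p^d` for some
prime `p > Z` have iterated-limsup box density tending to `0` as `Z → ∞`; the inner
limsup is taken over the `n`-th coordinate of the box, the outer one over the others. -/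
theorem stmt_13 (d : ℕ) (hd : 2 ≤ d) (n : Fin (2 * d + 2)) :
    Tendsto (fun Z : ℝ =>
        limsup (fun s : Fin (2 * d + 2) → ℝ =>
          limsup (fun t : ℝ =>
            (Nat.card ↥({Q : Fin (2 * d + 2) → ℤ |
                ∃ p : ℕ, p.Prime ∧ Z < (p : ℝ) ∧ (p : ℤ) ^ d ∣ resEval d Q} ∩
                box (Function.update s n t)) : ℝ) /
              (Nat.card ↥(box (Function.update s n t)) : ℝ)) atTop) atTop)
      atTop (nhds 0) := by
  refine tendsto_order.mpr ⟨fun b hb => .of_forall fun Z => hb.trans_le ?_, fun b hb => ?_⟩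
  · exact (limsup_mem_Icc_of_forall_mem fun s => limsup_mem_Icc_of_forall_mem fun t =>
      natCard_inter_box_div_mem_Icc _ _).1
  obtain ⟨N, hN⟩ := exists_eventually_card_le hd n (half_pos hb)
  filter_upwards [eventually_ge_atTop (N : ℝ)] with Z hZ
  have hZ0 : 0 ≤ Z := (Nat.cast_nonneg N).trans hZ
  refine lt_of_le_of_lt ?_ (half_lt_self hb)
  refine limsup_le_of_le (isBoundedUnder_of ⟨0, fun s => (limsup_mem_Icc_of_forall_mem fun t =>
    natCard_inter_box_div_mem_Icc _ _).1⟩).isCoboundedUnder_le ?_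
  filter_upwards [eventually_ge_atTop fun _ => (N : ℝ)] with s hs
  refine limsup_le_of_le (isBoundedUnder_of ⟨0, fun t =>
    (natCard_inter_box_div_mem_Icc _ _).1⟩).isCoboundedUnder_le ?_
  filter_upwards [eventually_ge_atTop 0, tendsto_nat_floor_atTop.eventually
    (hN ⌊Z⌋₊ (Nat.le_floor hZ) (fun i => ⌊s i⌋₊) fun i _ => Nat.le_floor (hs i))] with t ht h
  have hnn : ∀ i, 0 ≤ Function.update s n t i := fun i => by
    rcases eq_or_ne i n with rfl | hi
    · simpa using ht
    · simpa [hi] using (Nat.cast_nonneg N).trans (hs i)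
  have hfl : (fun i => ⌊Function.update s n t i⌋₊) =
      Function.update (fun i => ⌊s i⌋₊) n ⌊t⌋₊ := by
    ext1 i
    rcases eq_or_ne i n with rfl | hi
    · simp
    · simp [hi]
  have hbox := box_eq_symBox hnn
  rw [natCard_setOf_inter_box d hZ0 hnn, hbox, Nat.card_coe_set_eq, Set.ncard_coe_finset, hfl]
  exact div_le_of_le_mul₀ (by positivity) (by positivity) h
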